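/- arXiv:0904.4425 — 3 statements merged into one kernel-verified Lean document; each statement's English description precedes it below -/
import Mathlib

section
/- Let (R, 𝔪) be a complete Cohen–Macaulay Noetherian local ring of prime characteristic p in which every parameter ideal is Frobenius closed. Define B(R) = {P ∈ Spec R : P = I(x) for some parameter ideal I of R and some x ∈ R}, and A(R) = {P ∈ Spec R : P·R_P = J(y) for some parameter ideal J of the localization R_P and some y ∈ R_P}. Then B(R) ⊆ A(R), and the maximal elements of A(R) under inclusion coincide with the maximal elements of B(R) under inclusion. -/
/-- The `q`-th bracket power `I^{[q]}` of an ideal `I` in a ring of characteristic `p`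
(for `q = p^e`): the ideal generated by the `q`-th powers of the elements of `I`. -/
def bracketPow {R : Type*} [CommRing R] (I : Ideal R) (q : ℕ) : Ideal R :=
  Ideal.span ((fun a => a ^ q) '' (I : Set R))

/-- An ideal `I` of a ring of prime characteristic `p` is Frobenius closed if its Frobenius
closure `I^F = {x : x^q ∈ I^{[q]} for some q = p^e}` equals `I`, i.e. whenever
`x^{p^e} ∈ I^{[p^e]}` for some `e`, already `x ∈ I`. -/
def FrobeniusClosed {R : Type*} [CommRing R] (p : ℕ) (I : Ideal R) : Prop :=
  ∀ x : R, (∃ e : ℕ, x ^ p ^ e ∈ bracketPow I (p ^ e)) → x ∈ I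

/-- A parameter ideal of a `d`-dimensional Noetherian local ring: an ideal generated by a
system of parameters, i.e. by `d` elements generating an ideal primary to the maximal ideal
(equivalently, with radical equal to the maximal ideal). -/
def IsParameterIdeal {R : Type*} [CommRing R] [IsLocalRing R] (I : Ideal R) : Prop :=
  ∃ (n : ℕ) (x : Fin n → R), ringKrullDim R = n ∧ I = Ideal.span (Set.range x) ∧
    I.radical = IsLocalRing.maximalIdeal R

/-- A Noetherian local ring is Cohen–Macaulay if and only if some system of parameters is a
regular sequence; we take this characterization as the definition. -/
def IsCohenMacaulayLocal (R : Type*) [CommRing R] [IsLocalRing R] : Prop :=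
  ∃ (n : ℕ) (x : Fin n → R), ringKrullDim R = n ∧
    (Ideal.span (Set.range x)).radical = IsLocalRing.maximalIdeal R ∧
    RingTheory.Sequence.IsRegular R (List.ofFn x)

/-- `Ĩ(x)`: the ideal of all `c ∈ R` such that `c·x^q ∈ I^{[q]}` for every `q = p^e`. -/
def ITilde {R : Type*} [CommRing R] (p : ℕ) (I : Ideal R) (x : R) : Ideal R :=
  ⨅ e : ℕ, Submodule.colon (bracketPow I (p ^ e)) (Ideal.span {x ^ p ^ e})

/-- A Noetherian local ring is F-stable (in the sense relevant for F-injective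
Cohen–Macaulay rings) when its maximal ideal has the form `I(x)` for some parameter ideal `I`
and some element `x`. -/
def IsFStableLocal (p : ℕ) (A : Type*) [CommRing A] [IsLocalRing A] : Prop :=
  ∃ (I : Ideal A) (x : A), IsParameterIdeal I ∧ ITilde p I x = IsLocalRing.maximalIdeal A

/-- `B(R)`: the set of primes of the form `I(x)` for a parameter ideal `I` and `x ∈ R`. -/
def bSet (p : ℕ) (R : Type*) [CommRing R] [IsLocalRing R] : Set (Ideal R) :=
  {P : Ideal R | P.IsPrime ∧
    ∃ (I : Ideal R) (x : R), IsParameterIdeal I ∧ P = ITilde p I x}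

/-- `A(R)`: the set of primes `P` such that the localization `R_P` is F-stable, i.e.
`P·R_P = J(y)` for some parameter ideal `J` of `R_P` and some `y ∈ R_P`. -/
def aSet (p : ℕ) (R : Type*) [CommRing R] : Set (Ideal R) :=
  {P : Ideal R | ∃ h : P.IsPrime,
    haveI := h
    IsFStableLocal p (Localization.AtPrime P)}

open IsLocalRing

/-- The `k`-linear dual of an `R`-module, with `R` acting through the argument. -/
def ArgDual (k X : Type*) [Field k] [AddCommGroup X] [Module k X] : Type _ := X →ₗ[k] k

namespace ArgDual

variable {R k X Y : Type*} [CommRing R] [Field k] [Algebra k R]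
  [AddCommGroup X] [Module k X] [Module R X] [IsScalarTower k R X]
  [AddCommGroup Y] [Module k Y] [Module R Y] [IsScalarTower k R Y]

instance : AddCommGroup (ArgDual k X) := inferInstanceAs (AddCommGroup (X →ₗ[k] k))

instance : FunLike (ArgDual k X) X k := inferInstanceAs (FunLike (X →ₗ[k] k) X k)

instance : LinearMapClass (ArgDual k X) k X k :=
  inferInstanceAs (LinearMapClass (X →ₗ[k] k) k X k)

instance : Module R (ArgDual k X) where
  smul r f := LinearMap.comp (f : X →ₗ[k] k) (Algebra.lsmul k k X r)
  one_smul f := LinearMap.ext fun x => congrArg f (one_smul R x)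
  mul_smul r s f := LinearMap.ext fun x => congrArg f (by
    change (r * s) • x = s • r • x
    rw [mul_comm, mul_smul])
  smul_zero r := rfl
  smul_add r f g := rfl
  add_smul r s f := LinearMap.ext fun x => by
    change f ((r + s) • x) = f (r • x) + f (s • x)
    rw [add_smul, map_add]
  zero_smul f := LinearMap.ext fun x => by
    change f ((0 : R) • x) = 0
    rw [zero_smul, map_zero]

@[ext] lemma ext {f g : ArgDual k X} (h : ∀ x, f x = g x) : f = g := DFunLike.ext _ _ h

@[simp] lemma smul_apply (r : R) (f : ArgDual k X) (x : X) : (r • f) x = f (r • x) := rfl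
@[simp] lemma add_apply (f g : ArgDual k X) (x : X) : (f + g) x = f x + g x := rfl
@[simp] lemma zero_apply (x : X) : (0 : ArgDual k X) x = 0 := rfl

instance : IsScalarTower k R (ArgDual k X) where
  smul_assoc c r f := by
    ext x
    change f ((c • r) • x) = f (r • c • x)
    rw [smul_assoc, smul_comm]

@[simp] lemma sub_apply (f g : ArgDual k X) (x : X) : (f - g) x = f x - g x := rfl

instance [Module.Finite k X] : Module.Finite k (ArgDual k X) :=
  Module.Finite.of_surjective
    ({ toFun := fun f => f
       map_add' := fun _ _ => rfl
       map_smul' := fun c f => ArgDual.ext fun x => (f.map_smul c x).symm } :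
      (X →ₗ[k] k) →ₗ[k] ArgDual k X) fun f => ⟨f, rfl⟩

lemma sum_apply {ι : Type*} (s : Finset ι) (f : ι → ArgDual k X) (x : X) :
    (∑ i ∈ s, f i) x = ∑ i ∈ s, f i x :=
  LinearMap.sum_apply s f x

/-- Restriction of functionals along a linear map. -/
def map (φ : X →ₗ[R] Y) : ArgDual k Y →ₗ[R] ArgDual k X where
  toFun f := LinearMap.comp (f : Y →ₗ[k] k) (φ.restrictScalars k)
  map_add' _ _ := rfl
  map_smul' r f := by
    ext x
    change f (r • φ x) = f (φ (r • x))
    rw [φ.map_smul]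

@[simp] lemma map_apply (φ : X →ₗ[R] Y) (f : ArgDual k Y) (x : X) : map φ f x = f (φ x) := rfl

lemma map_surjective (φ : X →ₗ[R] Y) (hφ : Function.Injective φ) :
    Function.Surjective (map (k := k) φ) := by
  intro f
  obtain ⟨g, hg⟩ := LinearMap.exists_leftInverse_of_injective (φ.restrictScalars k)
    (LinearMap.ker_eq_bot.2 hφ)
  refine ⟨LinearMap.comp (f : X →ₗ[k] k) g, ?_⟩
  ext x
  change f (g (φ x)) = f x
  exact congrArg f (LinearMap.congr_fun hg x)

lemma exists_apply_ne_zero {x : X} (hx : x ≠ 0) : ∃ f : ArgDual k X, f x ≠ 0 := by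
  by_contra! h
  exact hx ((Module.forall_dual_apply_eq_zero_iff k x).1 h)

/-- A functional vanishing on the `I`-torsion is an `I`-combination of functionals. -/
lemma mem_ideal_smul_top [IsNoetherianRing R] (I : Ideal R) (f : ArgDual k X)
    (hf : ∀ x : X, (∀ a ∈ I, a • x = 0) → f x = 0) :
    f ∈ I • (⊤ : Submodule R (ArgDual k X)) := by
  classical
  obtain ⟨s, hs⟩ := (isNoetherianRing_iff_ideal_fg R).1 inferInstance I
  let α : X →ₗ[R] (s → X) := LinearMap.pi fun a => LinearMap.lsmul R X a.1
  have hker : LinearMap.ker (α.restrictScalars k) ≤ LinearMap.ker (f : X →ₗ[k] k) := by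
    intro x hx
    refine hf x fun a ha => ?_
    have hx' : ∀ b : s, b.1 • x = 0 := fun b => congrFun (show α x = 0 from hx) b
    rw [← hs] at ha
    induction ha using Submodule.span_induction with
    | mem b hb => exact hx' ⟨b, hb⟩
    | zero => simp
    | add b c _ _ hb hc => rw [add_smul, hb, hc, add_zero]
    | smul r b _ hb => rw [smul_assoc, hb, smul_zero]
  obtain ⟨g, hg⟩ : ∃ g : (s → X) →ₗ[k] k, g ∘ₗ (α.restrictScalars k) = (f : X →ₗ[k] k) := by
    obtain ⟨g, hg⟩ := LinearMap.exists_extend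
      ((LinearMap.ker (α.restrictScalars k)).liftQ (f : X →ₗ[k] k) hker ∘ₗ
        (α.restrictScalars k).quotKerEquivRange.symm.toLinearMap)
    refine ⟨g, LinearMap.ext fun x => ?_⟩
    have := LinearMap.congr_fun hg ((α.restrictScalars k).rangeRestrict x)
    rw [LinearMap.comp_apply] at this ⊢
    refine this.trans ?_
    rw [LinearMap.comp_apply, LinearEquiv.coe_coe]
    have h2 : (α.restrictScalars k).quotKerEquivRange.symm
        ((α.restrictScalars k).rangeRestrict x) = Submodule.Quotient.mk x := by
      rw [LinearEquiv.symm_apply_eq]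
      rfl
    rw [h2]
    rfl
  have hfe : f = ∑ a : s, a.1 • (show ArgDual k X from LinearMap.comp g (LinearMap.single k (fun _ => X) a)) := by
    ext x
    rw [sum_apply]
    have h1 : f x = g (α x) := (LinearMap.congr_fun hg x).symm
    rw [h1, ← LinearMap.sum_single_apply (fun _ => X) (α x), map_sum]
    rfl
  rw [hfe]
  refine Submodule.sum_mem _ fun a _ => Submodule.smul_mem_smul ?_ Submodule.mem_top
  rw [← hs]
  exact Submodule.subset_span a.2

end ArgDual

lemma IsPrecomplete.fun_of_finite {R ι : Type*} [CommRing R] (I : Ideal R) [Finite ι]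
    [IsPrecomplete I R] : IsPrecomplete I (ι → R) := by
  classical
  have := Fintype.ofFinite ι
  refine ⟨fun f hf => ?_⟩
  have hcoord : ∀ i, ∃ L, ∀ n, f n i ≡ L [SMOD (I ^ n • ⊤ : Submodule R R)] := by
    intro i
    refine IsPrecomplete.prec' (I := I) (fun n => f n i) fun {m n} hmn => ?_
    have := SModEq.map (hf hmn) (LinearMap.proj i : (ι → R) →ₗ[R] R)
    refine SModEq.mono ?_ this
    rw [Submodule.map_smul'']
    exact Submodule.smul_mono le_rfl le_top
  choose L hL using hcoord
  refine ⟨L, fun n => ?_⟩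
  rw [SModEq.sub_mem, ← LinearMap.sum_single_apply (fun _ => R) (f n - L)]
  refine Submodule.sum_mem _ fun i _ => ?_
  have h1 := SModEq.sub_mem.1 (hL i n)
  rw [smul_eq_mul, Ideal.mul_top] at h1
  have : LinearMap.single R (fun _ : ι => R) i ((f n - L) i) =
      (f n i - L i) • LinearMap.single R (fun _ : ι => R) i 1 := by
    rw [← map_smul, smul_eq_mul, mul_one]; rfl
  change LinearMap.single R (fun _ : ι => R) i ((f n - L) i) ∈ _
  rw [this]
  exact Submodule.smul_mem_smul h1 Submodule.mem_top

section CoefficientField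

variable {R k X : Type*} [CommRing R] [Field k] [Algebra k R]
  [AddCommGroup X] [Module k X] [Module R X] [IsScalarTower k R X]

lemma Submodule.fg_restrictScalars_of_pow_smul_eq_bot [IsNoetherianRing R] (I : Ideal R)
    (hk : ∀ r : R, ∃ c : k, r - algebraMap k R c ∈ I) (n : ℕ) :
    ∀ Y : Submodule R X, Y.FG → I ^ n • Y = ⊥ → (Y.restrictScalars k).FG := by
  induction n with
  | zero =>
    intro Y _ h
    rw [pow_zero, Ideal.one_eq_top, Submodule.top_smul] at h
    subst h
    exact (Submodule.restrictScalars_bot k R X).symm ▸ Submodule.fg_bot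
  | succ n ih =>
    intro Y hY h
    have h1 : ((I • Y).restrictScalars k).FG := by
      refine ih _ (Submodule.FG.smul ((isNoetherianRing_iff_ideal_fg R).1 inferInstance I) hY) ?_
      rw [← Submodule.mul_smul, ← pow_succ, h]
    obtain ⟨s, hs⟩ := hY
    have h2 : Y.restrictScalars k = Submodule.span k s ⊔ (I • Y).restrictScalars k := by
      apply le_antisymm
      · intro y hy
        rw [Submodule.restrictScalars_mem, ← hs] at hy
        induction hy using Submodule.span_induction with
        | mem b hb => exact Submodule.mem_sup_left (Submodule.subset_span hb)
        | zero => exact zero_mem _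
        | add b c _ _ hb hc => exact add_mem hb hc
        | smul r b hbs hb =>
          obtain ⟨c, hc⟩ := hk r
          have : r • b = c • b + (r - algebraMap k R c) • b := by
            rw [sub_smul, algebraMap_smul]; abel
          rw [this]
          refine add_mem (Submodule.smul_mem _ _ hb) (Submodule.mem_sup_right ?_)
          rw [hs] at hbs
          have hmem : (r - algebraMap k R c) • b ∈ I • Y := Submodule.smul_mem_smul hc hbs
          exact hmem
      · have h3 : I • Y ≤ Y := Submodule.smul_le_right
        refine sup_le ?_ ((show (I • Y).restrictScalars k ≤ Y.restrictScalars k from h3))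
        rw [Submodule.span_le]
        intro y hy
        change y ∈ Y
        rw [← hs]
        exact Submodule.subset_span hy
    rw [h2]
    exact Submodule.FG.sup (Submodule.fg_span s.finite_toSet) h1

lemma Module.finite_of_fg_of_pow_smul_eq_zero [IsNoetherianRing R] (I : Ideal R)
    (hk : ∀ r : R, ∃ c : k, r - algebraMap k R c ∈ I) (n : ℕ) (Y : Submodule R X) (hY : Y.FG)
    (h : ∀ a ∈ I ^ n, ∀ y ∈ Y, a • y = 0) : Module.Finite k Y := by
  have := Submodule.fg_restrictScalars_of_pow_smul_eq_bot (k := k) I hk n Y hY (by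
    rw [eq_bot_iff, Submodule.smul_le]
    exact fun a ha y hy => h a ha y hy)
  exact Module.Finite.iff_fg.2 this

/-- The dual of a torsion module with finite-dimensional socle is finitely generated. -/
lemma ArgDual.finite_of_finite_torsion [IsLocalRing R] [IsNoetherianRing R]
    [IsAdicComplete (maximalIdeal R) R]
    (Y : Submodule R X) (hY : ∀ x : X, (∀ a ∈ maximalIdeal R, a • x = 0) → x ∈ Y)
    [Module.Finite k Y] (hX : ∀ x : X, ∃ n, ∀ a ∈ maximalIdeal R ^ n, a • x = 0) :
    Module.Finite R (ArgDual k X) := by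
  have hfin : Module.Finite R (ArgDual k Y) := by
    exact Module.Finite.of_restrictScalars_finite k R _
  obtain ⟨s, hs⟩ := hfin.fg_top
  have hsurj := ArgDual.map_surjective (k := k) Y.subtype Y.injective_subtype
  choose g hg using hsurj
  let F : (s → R) →ₗ[R] ArgDual k X := Fintype.linearCombination R (fun i : s => g i)
  have hH : IsHausdorff (maximalIdeal R) (ArgDual k X) := by
    refine ⟨fun f hf => ?_⟩
    ext x
    obtain ⟨n, hn⟩ := hX x
    have := hf n
    rw [SModEq.zero] at this
    have key : ∀ f' ∈ maximalIdeal R ^ n • (⊤ : Submodule R (ArgDual k X)), f' x = 0 := by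
      intro f' hf'
      refine Submodule.smul_induction_on hf' (fun r hr f'' _ => ?_) fun a b ha hb => ?_
      · rw [ArgDual.smul_apply, hn r hr, map_zero]
      · rw [ArgDual.add_apply, ha, hb, add_zero]
    exact key f this
  have hF : Function.Surjective F := by
    have : IsPrecomplete (maximalIdeal R) (s → R) := IsPrecomplete.fun_of_finite _
    apply surjective_of_mkQ_comp_surjective (I := maximalIdeal R)
    intro y
    obtain ⟨f, rfl⟩ := Submodule.mkQ_surjective _ y
    have h1 : ArgDual.map Y.subtype f ∈ Submodule.span R (s : Set (ArgDual k Y)) := by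
      rw [hs]; exact Submodule.mem_top
    have h2 : Submodule.span R (s : Set (ArgDual k Y)) ≤
        (LinearMap.range F).map (ArgDual.map Y.subtype) := by
      rw [Submodule.span_le]
      intro v hv
      refine ⟨g v, ?_, hg v⟩
      rw [SetLike.mem_coe, LinearMap.mem_range]
      classical
      refine ⟨Pi.single ⟨v, hv⟩ 1, ?_⟩
      simp [F, Fintype.linearCombination_apply_single]
    obtain ⟨f', ⟨c, rfl⟩, hf'⟩ := h2 h1
    refine ⟨c, ?_⟩
    rw [LinearMap.comp_apply, Submodule.mkQ_apply, Submodule.mkQ_apply, Submodule.Quotient.eq]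
    apply ArgDual.mem_ideal_smul_top
    intro x hx
    have := congrArg (fun φ : ArgDual k Y => φ ⟨x, hY x hx⟩) hf'
    change F c x = f x at this
    rw [ArgDual.sub_apply]
    exact sub_eq_zero.2 this
  exact Module.Finite.of_surjective F hF

end CoefficientField

section HomToQuotient

variable {R : Type*} [CommRing R]

/-- Some generator of a finite module killed by `P`, but by no element outside `P`, has
annihilator exactly `P`. -/
lemma exists_smul_eq_zero_iff_mem_of_finite {M : Type*} [AddCommGroup M] [Module R M]
    (P : Ideal R) [P.IsPrime] (w : R) (s : Finset M) (hs : Submodule.span R (s : Set M) = ⊤)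
    (hP : ∀ a ∈ P, ∀ x : M, a • w • x = 0)
    (hw : ∀ a : R, (∀ x : M, a • w • x = 0) → a ∈ P) :
    ∃ x : M, ∀ a : R, a • w • x = 0 ↔ a ∈ P := by
  by_contra! h
  have h1 : ∀ x : M, ∃ a : R, a • w • x = 0 ∧ a ∉ P := by
    intro x
    rcases h x with ⟨a, ha⟩
    rcases ha with ha | ha
    · exact ⟨a, ha⟩
    · exact absurd (hP a ha.2 x) ha.1
  choose a ha haP using h1
  have hprod : ∏ x ∈ s, a x ∈ P := by
    refine hw _ fun x => ?_
    have hx : x ∈ Submodule.span R (s : Set M) := by rw [hs]; exact Submodule.mem_top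
    induction hx using Submodule.span_induction with
    | mem y hy =>
      obtain ⟨c, hc⟩ := Finset.dvd_prod_of_mem a hy
      rw [hc, mul_comm, mul_smul, ha, smul_zero]
    | zero => simp
    | add y z _ _ hy hz => rw [smul_add, smul_add, hy, hz, add_zero]
    | smul r y _ hy => rw [smul_comm w, smul_comm _ r, hy, smul_zero]
  obtain ⟨x, _, hx⟩ := (Ideal.IsPrime.prod_mem_iff (p := P)).1 hprod
  exact haP x hx

/-- A finite module over a domain not killed by a nonzero element has a nonzero dual. -/
lemma exists_ne_zero_linearMap_of_faithful {D M : Type*} [CommRing D] [IsDomain D]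
    [AddCommGroup M] [Module D M] [Module.Finite D M]
    (hM : ∀ a : D, (∀ x : M, a • x = 0) → a = 0) : ∃ g : M →ₗ[D] D, g ≠ 0 := by
  classical
  obtain ⟨s, hs⟩ := (inferInstance : Module.Finite D M).fg_top
  let V := LocalizedModule (nonZeroDivisors D) M
  let ι : M →ₗ[D] V := LocalizedModule.mkLinearMap (nonZeroDivisors D) M
  obtain ⟨x, hx⟩ : ∃ x : M, ι x ≠ 0 := by
    obtain ⟨x, hx⟩ := exists_smul_eq_zero_iff_mem_of_finite (⊥ : Ideal D) 1 s hs
      (fun a ha x => by rw [Ideal.mem_bot.1 ha, zero_smul])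
      (fun a ha => hM a fun x => by simpa using ha x)
    refine ⟨x, fun h => ?_⟩
    obtain ⟨c, hc⟩ := (IsLocalizedModule.eq_zero_iff (nonZeroDivisors D) ι).1 h
    exact nonZeroDivisors.coe_ne_zero c
      (Ideal.mem_bot.1 ((hx c).1 (by rw [one_smul]; exact hc)))
  obtain ⟨φ, hφ⟩ : ∃ φ : V →ₗ[Localization (nonZeroDivisors D)] FractionRing D, φ (ι x) ≠ 0 := by
    by_contra! h
    exact hx ((Module.forall_dual_apply_eq_zero_iff (FractionRing D) (ι x)).1 h)
  let φ' : M →ₗ[D] FractionRing D := (φ.restrictScalars D) ∘ₗ ι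
  obtain ⟨b, hb⟩ := IsLocalization.exist_integer_multiples_of_finset (nonZeroDivisors D)
    (s.image φ')
  have hb' : ∀ y : M, ∃ c : D, algebraMap D (FractionRing D) c = (b : D) • φ' y := by
    intro y
    have hy : y ∈ Submodule.span D (s : Set M) := by rw [hs]; exact Submodule.mem_top
    induction hy using Submodule.span_induction with
    | mem y hy => exact hb _ (Finset.mem_image_of_mem _ hy)
    | zero => exact ⟨0, by simp⟩
    | add y z _ _ hy hz =>
      obtain ⟨c, hc⟩ := hy
      obtain ⟨d, hd⟩ := hz
      exact ⟨c + d, by rw [map_add, hc, hd, map_add, smul_add]⟩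
    | smul r y _ hy =>
      obtain ⟨c, hc⟩ := hy
      exact ⟨r * c, by rw [map_mul, hc, map_smul, Algebra.smul_def, Algebra.smul_def,
        Algebra.smul_def]; ring⟩
  choose g hg using hb'
  have hinj := IsFractionRing.injective D (FractionRing D)
  refine ⟨⟨⟨g, fun y z => hinj ?_⟩, fun r y => hinj ?_⟩, fun h => ?_⟩
  · rw [map_add, hg, hg, hg, map_add, smul_add]
  · change algebraMap _ _ (g (r • y)) = algebraMap _ _ (r * g y)
    rw [map_mul, hg, hg, map_smul, Algebra.smul_def, Algebra.smul_def, Algebra.smul_def]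
    ring
  · have h0 : g x = 0 := LinearMap.congr_fun h x
    have := hg x
    rw [h0, map_zero, Algebra.smul_def, eq_comm, mul_eq_zero] at this
    rcases this with h2 | h2
    · exact nonZeroDivisors.coe_ne_zero b (hinj (by rw [h2, map_zero]))
    · exact hφ h2

lemma exists_ne_zero_linearMap_to_quotient {M : Type*} [AddCommGroup M] [Module R M]
    [Module.Finite R M] (P : Ideal R) [P.IsPrime] (hP : ∀ a ∈ P, ∀ x : M, a • x = 0)
    (hM : ∀ a : R, (∀ x : M, a • x = 0) → a ∈ P) : ∃ g : M →ₗ[R] (R ⧸ P), g ≠ 0 := by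
  let : Module (R ⧸ P) M := Module.IsTorsionBySet.module (I := P)
    ((Module.isTorsionBySet_iff_subset_annihilator _ _).2 fun a ha =>
      Module.mem_annihilator.2 (hP a ha))
  have : IsScalarTower R (R ⧸ P) M := Module.IsTorsionBySet.isScalarTower _
  have : Module.Finite (R ⧸ P) M := Module.Finite.of_restrictScalars_finite R (R ⧸ P) M
  obtain ⟨g, hg⟩ := exists_ne_zero_linearMap_of_faithful (D := R ⧸ P) (M := M) (by
    intro a ha
    obtain ⟨a, rfl⟩ := Ideal.Quotient.mk_surjective a
    refine Ideal.Quotient.eq_zero_iff_mem.2 (hM a fun x => ?_)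
    exact ha x)
  refine ⟨g.restrictScalars R, fun h => hg ?_⟩
  ext x
  exact LinearMap.congr_fun h x

end HomToQuotient

section InverseSystem

universe u

variable {R : Type u} [CommRing R]

/-- The direct limit of the cyclic modules `R ⧸ I n` along multiplication by `τ`. -/
lemma exists_module_of_mul_mem_iff (τ : R) (I : ℕ → Ideal R)
    (hI : ∀ n r, r * τ ∈ I (n + 1) ↔ r ∈ I n) :
    ∃ (H : Type u) (_ : AddCommGroup H) (_ : Module R H) (h : ℕ → H),
      (∀ n, τ • h (n + 1) = h n) ∧ (∀ n r, r • h n = 0 ↔ r ∈ I n) ∧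
      ∀ x, ∃ n, ∃ r : R, x = r • h n := by
  have hpow : ∀ j n r, r * τ ^ j ∈ I (n + j) ↔ r ∈ I n := by
    intro j
    induction j with
    | zero => simp
    | succ j ih =>
      intro n r
      rw [pow_succ, ← mul_assoc, ← add_assoc, hI, ih]
  have hle : ∀ i j, i ≤ j → I i ≤ Submodule.comap (LinearMap.lsmul R R (τ ^ (j - i))) (I j) := by
    intro i j hij r hr
    obtain ⟨l, rfl⟩ := Nat.exists_eq_add_of_le hij
    rw [Submodule.mem_comap, LinearMap.lsmul_apply, smul_eq_mul, Nat.add_sub_cancel_left, mul_comm]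
    exact (hpow l i r).2 hr
  let f : ∀ i j, i ≤ j → (R ⧸ I i) →ₗ[R] (R ⧸ I j) := fun i j hij =>
    Submodule.mapQ (I i) (I j) (LinearMap.lsmul R R (τ ^ (j - i))) (hle i j hij)
  have hf : ∀ i j hij r, f i j hij (Submodule.Quotient.mk r) =
      Submodule.Quotient.mk (τ ^ (j - i) * r) := fun i j hij r => rfl
  have hds : DirectedSystem (fun n => R ⧸ I n) fun i j hij => f i j hij := by
    refine ⟨fun i x => ?_, fun i j l hij hjl x => ?_⟩
    · obtain ⟨r, rfl⟩ := Submodule.Quotient.mk_surjective _ x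
      rw [hf i i le_rfl, Nat.sub_self, pow_zero, one_mul]
    · obtain ⟨r, rfl⟩ := Submodule.Quotient.mk_surjective _ x
      rw [hf _ _ hij, hf _ _ hjl, hf _ _ (hij.trans hjl), ← mul_assoc, ← pow_add]
      congr 3
      omega
  let H := Module.DirectLimit (fun n => R ⧸ I n) f
  let ι := Module.DirectLimit.of R ℕ (fun n => R ⧸ I n) f
  refine ⟨H, inferInstance, inferInstance, fun n => ι n (Submodule.Quotient.mk 1), ?_, ?_, ?_⟩
  · intro n
    have h1 : ι (n + 1) (f n (n + 1) n.le_succ (Submodule.Quotient.mk 1)) =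
        ι n (Submodule.Quotient.mk 1) := Module.DirectLimit.of_f (hij := n.le_succ)
    rw [hf n (n + 1) n.le_succ] at h1
    change τ • ι (n + 1) _ = ι n _
    rw [← h1, ← map_smul]
    congr 1
    rw [← Submodule.Quotient.mk_smul]
    simp
  · intro n r
    rw [← map_smul, ← Submodule.Quotient.mk_smul, smul_eq_mul, mul_one]
    constructor
    · intro h0
      obtain ⟨j, hij, hj⟩ := Module.DirectLimit.of.zero_exact h0
      obtain ⟨l, rfl⟩ := Nat.exists_eq_add_of_le hij
      have hj' : (Submodule.Quotient.mk (τ ^ (n + l - n) * r) : R ⧸ I (n + l)) = 0 := hj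
      rw [Submodule.Quotient.mk_eq_zero, Nat.add_sub_cancel_left, mul_comm] at hj'
      exact (hpow l n r).1 hj'
    · intro hr
      rw [(Submodule.Quotient.mk_eq_zero _).2 hr, map_zero]
  · intro x
    obtain ⟨n, y, rfl⟩ := Module.DirectLimit.exists_of x
    obtain ⟨r, rfl⟩ := Submodule.Quotient.mk_surjective _ y
    refine ⟨n, r, ?_⟩
    change _ = r • ι n _
    rw [← map_smul, ← Submodule.Quotient.mk_smul, smul_eq_mul, mul_one]

/-- Local duality in elementary terms: if both `N` and the multiples of `w₀` have annihilator
exactly `P` in the direct limit of the `R ⧸ I n`, then there is a nonzero compatible system in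
the inverse limit of the `N n / I n`. -/
theorem exists_compatible_sequence {k : Type*} [Field k] [Algebra k R] [IsLocalRing R]
    [IsNoetherianRing R] [IsAdicComplete (maximalIdeal R) R]
    (hk : ∀ r : R, ∃ c : k, r - algebraMap k R c ∈ maximalIdeal R)
    (P : Ideal R) [P.IsPrime] (τ w₀ : R) (I N : ℕ → Ideal R)
    (hI : ∀ n r, r * τ ∈ I (n + 1) ↔ r ∈ I n)
    (hdiv : ∀ n m, n ≤ m → ∀ r, (∀ a ∈ I n, a * r ∈ I m) → ∃ b, r - b * τ ^ (m - n) ∈ I m)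
    (hIm : ∀ n, I n ≤ maximalIdeal R) (hmI : ∀ n, ∃ c, maximalIdeal R ^ c ≤ I n)
    (hIN : ∀ n, I n ≤ N n) (hN : ∀ n r, r * τ ∈ N (n + 1) ↔ r ∈ N n)
    (hPN : ∀ a ∈ P, ∀ n, ∀ r ∈ N n, a * r ∈ I n)
    (hsN : ∀ s, (∀ n, ∀ r ∈ N n, s * r ∈ I n) → s ∈ P)
    (hPw : ∀ a ∈ P, ∀ n, a * w₀ ∈ I n) (hsw : ∀ s, (∀ n, s * w₀ ∈ I n) → s ∈ P) :
    ∃ w : ℕ → R, (∀ n, w n ∈ N n) ∧ (∀ n, w (n + 1) - w n ∈ I n) ∧ ∃ n, w n ∉ I n := by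
  obtain ⟨H, _, _, h, hτ, hann, hex⟩ := exists_module_of_mul_mem_iff τ I hI
  have hτpow : ∀ j n, τ ^ j • h (n + j) = h n := by
    intro j
    induction j with
    | zero => simp
    | succ j ih => intro n; rw [pow_succ, mul_smul, ← add_assoc, hτ, ih]
  have hNpow : ∀ j n r, r * τ ^ j ∈ N (n + j) ↔ r ∈ N n := by
    intro j
    induction j with
    | zero => simp
    | succ j ih =>
      intro n r
      rw [pow_succ, ← mul_assoc, ← add_assoc, hN, ih]
  let _ : Module k H := Module.compHom H (algebraMap k R)
  have : IsScalarTower k R H := ⟨fun c r x => by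
    change (c • r) • x = algebraMap k R c • r • x
    rw [Algebra.smul_def, mul_smul]⟩
  have hcyc : ∀ n, ∀ x : H, (∀ a ∈ I n, a • x = 0) → ∃ r : R, x = r • h n := by
    intro n x hx
    obtain ⟨m, r, rfl⟩ := hex x
    have e : r • h m = (r * τ ^ n) • h (m + n) := by rw [mul_smul, hτpow]
    rw [e] at hx ⊢
    obtain ⟨b, hb⟩ := hdiv n (m + n) (Nat.le_add_left _ _) (r * τ ^ n) (fun a ha => by
      rw [← hann, mul_smul]; exact hx a ha)
    refine ⟨b, ?_⟩
    rw [← hann, sub_smul, sub_eq_zero] at hb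
    rw [hb, Nat.add_sub_cancel, mul_smul, Nat.add_comm m n, hτpow]
  -- the submodule of `H` cut out by `N`
  let NH : Submodule R H :=
    { carrier := {x | ∃ n, ∃ r ∈ N n, x = r • h n}
      zero_mem' := ⟨0, 0, zero_mem _, by simp⟩
      add_mem' := by
        rintro x y ⟨n, r, hr, rfl⟩ ⟨m, s, hs, rfl⟩
        refine ⟨n + m, r * τ ^ m + s * τ ^ n, add_mem ((hNpow _ _ _).2 hr) ?_, ?_⟩
        · rw [Nat.add_comm]; exact (hNpow _ _ _).2 hs
        · rw [add_smul, mul_smul, mul_smul, hτpow, Nat.add_comm n m, hτpow]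
      smul_mem' := by
        rintro c x ⟨n, r, hr, rfl⟩
        exact ⟨n, c * r, Ideal.mul_mem_left _ _ hr, by rw [mul_smul]⟩ }
  have hNH : ∀ n r, r • h n ∈ NH → r ∈ N n := by
    rintro n r ⟨m, s, hs, e⟩
    rw [← hNpow m]
    have h1 : r * τ ^ m - s * τ ^ n ∈ I (n + m) := by
      rw [← hann, sub_smul, mul_smul, mul_smul, hτpow, Nat.add_comm n m, hτpow, e, sub_self]
    have h2 : s * τ ^ n ∈ N (n + m) := by
      rw [Nat.add_comm]; exact (hNpow _ _ _).2 hs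
    simpa using add_mem (hIN _ h1) h2
  have hfin : ∀ n, Module.Finite k (Submodule.span R {h n}) := by
    intro n
    obtain ⟨c, hc⟩ := hmI n
    refine Module.finite_of_fg_of_pow_smul_eq_zero (maximalIdeal R) hk c _
      (Submodule.fg_span_singleton _) fun a ha y hy => ?_
    obtain ⟨r, rfl⟩ := Submodule.mem_span_singleton.1 hy
    rw [smul_comm, (hann n a).2 (hc ha), smul_zero]
  have hDH : Module.Finite R (ArgDual k H) := by
    have := hfin 0
    refine ArgDual.finite_of_finite_torsion (Submodule.span R {h 0}) (fun x hx => ?_) fun x => ?_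
    · obtain ⟨r, rfl⟩ := hcyc 0 x fun a ha => hx a (hIm 0 ha)
      exact Submodule.smul_mem _ _ (Submodule.mem_span_singleton_self _)
    · obtain ⟨n, r, rfl⟩ := hex x
      obtain ⟨c, hc⟩ := hmI n
      exact ⟨c, fun a ha => by rw [smul_comm, (hann n a).2 (hc ha), smul_zero]⟩
  have hDN : Module.Finite R (ArgDual k NH) :=
    Module.Finite.of_surjective _ (ArgDual.map_surjective (k := k) NH.subtype
      NH.injective_subtype)
  obtain ⟨s, hs⟩ := hDH.fg_top
  obtain ⟨φ, hφ⟩ := exists_smul_eq_zero_iff_mem_of_finite P w₀ s hs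
    (fun a ha f => by
      ext x
      obtain ⟨n, r, rfl⟩ := hex x
      rw [ArgDual.smul_apply, ArgDual.smul_apply, smul_comm _ r, smul_comm _ r, ← mul_smul w₀,
        mul_comm, (hann n _).2 (hPw a ha n), smul_zero, map_zero, ArgDual.zero_apply])
    (fun a ha => hsw a fun n => by
      by_contra hne
      rw [← hann] at hne
      obtain ⟨f, hf⟩ := ArgDual.exists_apply_ne_zero (k := k) hne
      have := congrArg (fun g : ArgDual k H => g (h n)) (ha f)
      apply hf
      rw [mul_comm, mul_smul]
      exact this)
  obtain ⟨g, hg⟩ := exists_ne_zero_linearMap_to_quotient (M := ArgDual k NH) P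
    (fun a ha f => by
      ext ⟨x, n, r, hr, rfl⟩
      rw [ArgDual.smul_apply, ArgDual.zero_apply, ← map_zero f]
      congr 1
      ext
      change a • r • h n = 0
      rw [← mul_smul, hann]
      exact hPN a ha n r hr)
    (fun a ha => hsN a fun n r hr => by
      by_contra hne
      rw [← hann] at hne
      have hne' : a • (⟨r • h n, n, r, hr, rfl⟩ : NH) ≠ 0 := fun h0 => hne (by
        rw [mul_smul]; exact congrArg Subtype.val h0)
      obtain ⟨f, hf⟩ := ArgDual.exists_apply_ne_zero (k := k) hne'
      exact hf (congrArg (fun g : ArgDual k NH => g _) (ha f)))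
  -- the nonzero map of duals
  let Φ : (R ⧸ P) →ₗ[R] ArgDual k H := Submodule.liftQ P
    (LinearMap.toSpanSingleton R (ArgDual k H) (w₀ • φ)) fun a ha => (hφ a).2 ha
  have hΦ : ∀ x, Φ x = 0 → x = 0 := by
    intro x hx
    obtain ⟨a, rfl⟩ := Submodule.Quotient.mk_surjective _ x
    exact (Submodule.Quotient.mk_eq_zero _).2 ((hφ a).1 hx)
  let G : ArgDual k NH →ₗ[R] ArgDual k H := Φ ∘ₗ g
  have hG : ∃ f, G f ≠ 0 := by
    by_contra! h0
    exact hg (LinearMap.ext fun f => hΦ _ (h0 f))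
  have hξ : ∀ n, ∃ ξ : NH, (∀ a ∈ I n, a • ξ = 0) ∧ ∀ f : ArgDual k NH, G f (h n) = f ξ := by
    intro n
    let T : Submodule R NH :=
      { carrier := {x | ∀ a ∈ I n, a • x = 0}
        zero_mem' := fun a _ => smul_zero a
        add_mem' := fun {x y} hx hy a ha => by rw [smul_add, hx a ha, hy a ha, add_zero]
        smul_mem' := fun c x hx a ha => by rw [smul_comm, hx a ha, smul_zero] }
    have hT : Module.Finite k T := by
      have := hfin n
      let j : T →ₗ[k] Submodule.span R {h n} :=
        { toFun := fun x => ⟨x.1.1, by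
            obtain ⟨r, hr⟩ := hcyc n x.1.1 fun a ha => congrArg Subtype.val (x.2 a ha)
            rw [hr]
            exact Submodule.smul_mem _ _ (Submodule.mem_span_singleton_self _)⟩
          map_add' := fun _ _ => rfl
          map_smul' := fun _ _ => rfl }
      refine Module.Finite.of_injective j fun x y hxy => ?_
      have h1 : (j x).1 = (j y).1 := by rw [hxy]
      exact Subtype.ext (Subtype.ext h1)
    obtain ⟨res, hres_apply, hres⟩ : ∃ res : ArgDual k NH →ₗ[R] ArgDual k T,
        (∀ f x, res f x = f x.1) ∧ Function.Surjective res :=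
      ⟨ArgDual.map T.subtype, fun _ _ => rfl,
        ArgDual.map_surjective (k := k) T.subtype T.injective_subtype⟩
    have hwell : ∀ f f' : ArgDual k NH, res f = res f' →
        G f (h n) = G f' (h n) := by
      intro f f' hff
      have h1 : f - f' ∈ I n • (⊤ : Submodule R (ArgDual k NH)) := by
        refine ArgDual.mem_ideal_smul_top _ _ fun x hx => ?_
        rw [ArgDual.sub_apply, sub_eq_zero]
        rw [← hres_apply f ⟨x, hx⟩, hff, hres_apply]
      have h2 : ∀ q ∈ I n • (⊤ : Submodule R (ArgDual k NH)), G q (h n) = 0 := by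
        intro q hq
        refine Submodule.smul_induction_on hq (fun r hr q' _ => ?_) fun a b ha hb => ?_
        · rw [map_smul, ArgDual.smul_apply, (hann n r).2 hr, map_zero]
        · rw [map_add, ArgDual.add_apply, ha, hb, add_zero]
      have h3 := h2 _ h1
      rw [map_sub, ArgDual.sub_apply, sub_eq_zero] at h3
      exact h3
    choose l hl using hres
    have hadd : ∀ q q' : ArgDual k T, G (l (q + q')) (h n) = G (l q) (h n) + G (l q') (h n) := by
      intro q q'
      rw [← ArgDual.add_apply, ← map_add]
      apply hwell
      rw [map_add, hl, hl, hl]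
    have hsmul : ∀ (c : k) (q : ArgDual k T), G (l (algebraMap k R c • q)) (h n) =
        c • G (l q) (h n) := by
      intro c q
      have e : c • G (l q) (h n) = G (algebraMap k R c • l q) (h n) := by
        rw [map_smul, ArgDual.smul_apply, algebraMap_smul]
        exact ((G (l q) : H →ₗ[k] k).map_smul c (h n)).symm
      rw [e]
      apply hwell
      rw [map_smul, hl, hl]
    let Λ : Module.Dual k (Module.Dual k T) :=
      { toFun := fun q => G (l q) (h n)
        map_add' := hadd
        map_smul' := fun c q => by
          have e : (show ArgDual k T from c • q) = algebraMap k R c • (show ArgDual k T from q) := by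
            refine LinearMap.ext fun x => ?_
            change c • q x = q (algebraMap k R c • x)
            rw [algebraMap_smul, map_smul]
          exact (congrArg (fun q' : ArgDual k T => G (l q') (h n)) e).trans (hsmul c q) }
    obtain ⟨ξ, hξ⟩ := (Module.evalEquiv k T).surjective Λ
    refine ⟨ξ.1, ξ.2, fun f => ?_⟩
    have h1 : Λ (res f) = f ξ.1 := by
      rw [← hξ]; exact hres_apply f ξ
    rw [← h1]
    exact hwell _ _ (hl _).symm
  choose ξ hξI hξ using hξ
  have hξτ : ∀ n, τ • ξ (n + 1) = ξ n := by
    intro n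
    by_contra hne
    obtain ⟨f, hf⟩ := ArgDual.exists_apply_ne_zero (k := k) (sub_ne_zero.2 hne)
    apply hf
    rw [map_sub, ← ArgDual.smul_apply, ← hξ, ← hξ, map_smul, ArgDual.smul_apply, hτ, sub_self]
  have hw : ∀ n, ∃ r : R, (ξ n : H) = r • h n := fun n =>
    hcyc n _ fun a ha => congrArg Subtype.val (hξI n a ha)
  choose w hw using hw
  refine ⟨w, fun n => hNH n _ (hw n ▸ (ξ n).2), fun n => ?_, ?_⟩
  · rw [← hann, sub_smul, ← hw, ← hξτ n, sub_eq_zero]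
    change w (n + 1) • h n = τ • (ξ (n + 1) : H)
    rw [hw, smul_comm τ, hτ]
  · by_contra! h0
    obtain ⟨f, hf⟩ := hG
    apply hf
    ext x
    obtain ⟨n, r, rfl⟩ := hex x
    have hz : ξ n = 0 := Subtype.ext (by rw [hw, (hann n _).2 (h0 n)]; rfl)
    rw [← ArgDual.smul_apply, ← map_smul, hξ, hz, map_zero, ArgDual.zero_apply]

end InverseSystem

section CoefficientFieldExistence

open Polynomial in
/-- A ring map from a field of characteristic `p` lifts along a square-zero extension. -/
lemma exists_lift_of_sq_eq_bot {κ B : Type*} [Field κ] [CommRing B] (p : ℕ) [hp : Fact p.Prime]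
    [CharP κ p] [CharP B p] (I : Ideal B) (hI : I ^ 2 = ⊥) (f : κ →+* B ⧸ I) :
    ∃ g : κ →+* B, ∀ x, Ideal.Quotient.mk I (g x) = f x := by
  classical
  have hIp : ∀ b ∈ I, b ^ p = 0 := by
    intro b hb
    have : b ^ 2 ∈ I ^ 2 := Ideal.pow_mem_pow hb 2
    rw [hI, Ideal.mem_bot] at this
    exact pow_eq_zero_of_le hp.out.two_le this
  let F : Subring (κ × B) :=
    RingHom.eqLocus (f.comp (RingHom.fst κ B)) ((Ideal.Quotient.mk I).comp (RingHom.snd κ B))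
  have hF : ∀ x, x ∈ F ↔ f x.1 = Ideal.Quotient.mk I x.2 := fun x => Iff.rfl
  let G₀ : Subring (κ × B) := F.map (frobenius (κ × B) p)
  have hG₀ : ∀ x ∈ F, x ^ p ∈ G₀ := fun x hx => ⟨x, hx, rfl⟩
  let S : Set (Subring (κ × B)) := {G | G₀ ≤ G ∧ G ≤ F ∧ ∀ x ∈ G, x.1 = 0 → x.2 = 0}
  have hS₀ : G₀ ∈ S := by
    refine ⟨le_rfl, ?_, ?_⟩
    · rintro _ ⟨x, hx, rfl⟩
      exact pow_mem (show x ∈ F from hx) p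
    · rintro _ ⟨x, hx, rfl⟩ h0
      have h1 : x.1 = 0 := eq_zero_of_pow_eq_zero (n := p) h0
      have h2 := (hF x).1 hx
      rw [h1, map_zero, eq_comm, Ideal.Quotient.eq_zero_iff_mem] at h2
      exact hIp _ h2
  obtain ⟨G, -, hG⟩ := zorn_le_nonempty₀ S (fun c hcS hc y hy => by
    refine ⟨sSup c, ⟨(hcS hy).1.trans (le_sSup hy), sSup_le fun z hz => (hcS hz).2.1, ?_⟩,
      fun z hz => le_sSup hz⟩
    intro x hx
    obtain ⟨z, hz, hxz⟩ := (Subring.mem_sSup_of_directedOn ⟨y, hy⟩ hc.directedOn).1 hx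
    exact (hcS hz).2.2 x hxz) G₀ hS₀
  obtain ⟨hG₀G, hGF, hGinj⟩ := hG.prop
  let L : Subfield κ :=
    { (G.map (RingHom.fst κ B)) with
      inv_mem' := by
        rintro _ ⟨x, hx, rfl⟩
        by_cases h0 : x.1 = 0
        · exact ⟨0, G.zero_mem, by simp [h0]⟩
        obtain ⟨b, hb⟩ := Ideal.Quotient.mk_surjective (f x.1⁻¹)
        refine ⟨x ^ (p - 1) * (x.1⁻¹, b) ^ p,
          G.mul_mem (pow_mem hx _) (hG₀G (hG₀ _ hb.symm)), ?_⟩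
        change x.1 ^ (p - 1) * x.1⁻¹ ^ p = x.1⁻¹
        obtain ⟨m, hm⟩ := Nat.exists_eq_succ_of_ne_zero hp.out.ne_zero
        rw [hm, Nat.succ_sub_one, pow_succ, ← mul_assoc, ← mul_pow, mul_inv_cancel₀ h0, one_pow,
          one_mul] }
  have hL : ∀ x, x ∈ L ↔ ∃ b, (x, b) ∈ G := by
    intro x
    constructor
    · rintro ⟨y, hy, rfl⟩; exact ⟨y.2, hy⟩
    · rintro ⟨b, hb⟩; exact ⟨_, hb, rfl⟩
  let ι : G →+* L :=
    { toFun := fun y => ⟨y.1.1, (hL _).2 ⟨y.1.2, y.2⟩⟩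
      map_one' := rfl
      map_zero' := rfl
      map_add' := fun _ _ => rfl
      map_mul' := fun _ _ => rfl }
  have hι : Function.Injective ι := by
    rw [injective_iff_map_eq_zero]
    intro y hy
    have h1 : y.1.1 = 0 := congrArg Subtype.val hy
    exact Subtype.ext (Prod.ext h1 (hGinj _ y.2 h1))
  have hsurj : ∀ x, ∃ b, (x, b) ∈ G := by
    intro x
    by_contra hx
    obtain ⟨b, hb⟩ := Ideal.Quotient.mk_surjective (f x)
    have hxb : (x, b) ∈ F := hb.symm
    have hxp : (x, b) ^ p ∈ G := hG₀G (hG₀ _ hxb)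
    let c : G := ⟨(x, b) ^ p, hxp⟩
    let ev : G[X] →+* κ × B := Polynomial.eval₂RingHom G.subtype (x, b)
    have hev0 : ev (X ^ p - C c) = 0 := by
      simp [ev, c]
    have hmonic : (X ^ p - C c).Monic := monic_X_pow_sub_C c hp.out.ne_zero
    have hirr : Irreducible (X ^ p - C (ι c)) := by
      refine X_pow_sub_C_irreducible_of_prime hp.out fun d hd => hx ((hL x).1 ?_)
      have h1 : (d : κ) ^ p = x ^ p := congrArg Subtype.val hd
      have h2 : (d : κ) = x := frobenius_inj κ p h1
      rw [← h2]
      exact d.2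
    have hmin : minpoly L x = X ^ p - C (ι c) := by
      refine (minpoly.eq_of_irreducible_of_monic hirr ?_
        (monic_X_pow_sub_C _ hp.out.ne_zero)).symm
      rw [map_sub, map_pow, aeval_X, aeval_C, sub_eq_zero]
      rfl
    have hevfst : ∀ P : G[X], (ev P).1 = aeval x (P.map ι) := by
      intro P
      have : (RingHom.fst κ B).comp ev =
          ((aeval x : L[X] →ₐ[L] κ) : L[X] →+* κ).comp (Polynomial.mapRingHom ι) := by
        refine Polynomial.ringHom_ext (fun a => ?_) ?_
        · simp [ev]; rfl
        · simp [ev]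
      exact RingHom.congr_fun this P
    have hevker : ∀ P : G[X], (ev P).1 = 0 → ev P = 0 := by
      intro P hP
      have hdiv := modByMonic_add_div P (X ^ p - C c)
      have h1 : ev P = ev (P %ₘ (X ^ p - C c)) := by
        conv_lhs => rw [← hdiv]
        rw [map_add, map_mul, hev0, zero_mul, add_zero]
      rw [h1] at hP ⊢
      rw [hevfst] at hP
      have h2 : (P %ₘ (X ^ p - C c)).map ι = 0 := by
        by_contra hne
        have h3 := minpoly.degree_le_of_ne_zero L x hne hP
        rw [hmin, degree_X_pow_sub_C hp.out.pos] at h3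
        have : Nontrivial G := ⟨0, 1, fun h => by
          have := congrArg (fun y : G => y.1.1) h
          exact zero_ne_one this⟩
        have h4 := degree_modByMonic_lt P hmonic
        rw [degree_X_pow_sub_C hp.out.pos] at h4
        exact absurd (h3.trans (degree_map_le)) (not_le.2 h4)
      rw [Polynomial.map_eq_zero_iff hι] at h2
      rw [h2, map_zero]
    have hGG' : G ≤ ev.range := fun y hy => ⟨C ⟨y, hy⟩, by simp [ev]⟩
    have hmem : ev.range ∈ S := by
      refine ⟨hG₀G.trans hGG', ?_, ?_⟩
      · rintro _ ⟨P, rfl⟩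
        change eval₂ G.subtype (x, b) P ∈ F
        rw [eval₂_eq_sum_range]
        exact sum_mem fun i _ => mul_mem (hGF (P.coeff i).2) (pow_mem hxb i)
      · rintro _ ⟨P, rfl⟩ hP
        rw [hevker P hP]; rfl
    exact hx ⟨b, hG.le_of_ge hmem hGG' ⟨X, by simp [ev]⟩⟩
  have huniq : ∀ x b b', (x, b) ∈ G → (x, b') ∈ G → b = b' := by
    intro x b b' hb hb'
    have := hGinj _ (G.sub_mem hb hb') (sub_self x)
    exact sub_eq_zero.1 this
  choose g hg using hsurj
  refine ⟨⟨⟨⟨g, huniq _ _ _ (hg 1) G.one_mem⟩, fun x y => ?_⟩,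
    huniq _ _ _ (hg 0) G.zero_mem, fun x y => ?_⟩, fun x => ((hF _).1 (hGF (hg x))).symm⟩
  · exact huniq _ _ _ (hg (x * y)) (G.mul_mem (hg x) (hg y))
  · exact huniq _ _ _ (hg (x + y)) (G.add_mem (hg x) (hg y))

/-- A complete local ring of prime characteristic contains a coefficient field. -/
theorem exists_residueField_section {R : Type*} [CommRing R] [IsLocalRing R] (p : ℕ)
    [Fact p.Prime] [CharP R p] [IsAdicComplete (maximalIdeal R) R] :
    ∃ g : ResidueField R →+* R, ∀ x, residue R (g x) = x := by
  let _ : Algebra (ZMod p) R := ZMod.algebra R p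
  have : CharP (ResidueField R) p := by
    have := charP_of_injective_algebraMap (algebraMap (ZMod p) (ResidueField R)).injective p
    exact this
  have : Algebra.FormallySmooth (ZMod p) (ResidueField R) := by
    refine .of_comp_surjective fun B _ _ I hI f => ?_
    rcases subsingleton_or_nontrivial B with hB | hB
    · let g : ResidueField R →ₐ[ZMod p] B :=
        { toFun := fun _ => 0
          map_one' := Subsingleton.elim _ _
          map_mul' := fun _ _ => Subsingleton.elim _ _
          map_zero' := rfl
          map_add' := fun _ _ => Subsingleton.elim _ _
          commutes' := fun _ => Subsingleton.elim _ _ }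
      have : Subsingleton (B ⧸ I) := Ideal.Quotient.mk_surjective.subsingleton
      exact ⟨g, AlgHom.ext fun _ => Subsingleton.elim _ _⟩
    · have : CharP B p :=
        charP_of_injective_algebraMap (algebraMap (ZMod p) B).injective p
      obtain ⟨g, hg⟩ := exists_lift_of_sq_eq_bot p I hI f.toRingHom
      refine ⟨{ g with commutes' := fun c => ?_ }, AlgHom.ext hg⟩
      exact RingHom.congr_fun (Subsingleton.elim (g.comp (algebraMap _ _)) (algebraMap _ _)) c
  obtain ⟨g, hg⟩ := Algebra.FormallySmooth.exists_mkₐ_comp_eq_of_isAdicComplete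
    (R := ZMod p) (I := maximalIdeal R) (AlgHom.id (ZMod p) (ResidueField R))
  exact ⟨g, fun x => AlgHom.congr_fun hg x⟩

end CoefficientFieldExistence

section SystemOfParameters

open RingTheory.Sequence

/-- A system of parameters of a local ring, as a list of elements. -/
def IsSystemOfParameters {R : Type*} [CommRing R] [IsLocalRing R] (xs : List R) : Prop :=
  ringKrullDim R = xs.length ∧ (Ideal.ofList xs).radical = maximalIdeal R

/-- Every element of a system of parameters is a nonzerodivisor modulo the preceding ones. -/
def HasRegularSystemsOfParameters (R : Type*) [CommRing R] [IsLocalRing R] : Prop :=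
  ∀ (ys : List R) (t : R) (ts : List R), IsSystemOfParameters (ys ++ t :: ts) →
    ∀ r, t * r ∈ Ideal.ofList ys → r ∈ Ideal.ofList ys

theorem isWeaklyRegular_append_singleton_iff {R : Type*} [CommRing R] (xs : List R) (a : R) :
    IsWeaklyRegular R (xs ++ [a]) ↔ IsWeaklyRegular R xs ∧
      ∀ r, a * r ∈ Ideal.ofList xs → r ∈ Ideal.ofList xs := by
  rw [isWeaklyRegular_append_iff, isWeaklyRegular_singleton_iff]
  refine and_congr_right fun _ => ?_
  rw [isSMulRegular_iff_right_eq_zero_of_smul]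
  constructor
  · intro h r hr
    have := h (Submodule.Quotient.mk r) (by
      rw [← Submodule.Quotient.mk_smul, Submodule.Quotient.mk_eq_zero]
      simpa using hr)
    rw [Submodule.Quotient.mk_eq_zero] at this
    simpa using this
  · intro h x hx
    obtain ⟨r, rfl⟩ := Submodule.Quotient.mk_surjective _ x
    rw [← Submodule.Quotient.mk_smul, Submodule.Quotient.mk_eq_zero] at hx
    rw [Submodule.Quotient.mk_eq_zero]
    simpa using h r (by simpa using hx)

theorem isWeaklyRegular_iff_forall_append {R : Type*} [CommRing R] (xs : List R) :
    IsWeaklyRegular R xs ↔ ∀ (ys : List R) (t : R) (ts : List R), xs = ys ++ t :: ts →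
      ∀ r, t * r ∈ Ideal.ofList ys → r ∈ Ideal.ofList ys := by
  induction xs using List.reverseRecOn with
  | nil => simp
  | append_singleton xs a ih =>
    rw [isWeaklyRegular_append_singleton_iff, ih]
    constructor
    · rintro ⟨h1, h2⟩ ys t ts h
      rcases List.eq_nil_or_concat ts with rfl | ⟨ts', b, rfl⟩
      · obtain ⟨rfl, h'⟩ := List.append_inj' h rfl
        obtain rfl : a = t := by simpa using h'
        exact h2
      · rw [List.concat_eq_append, ← List.cons_append, ← List.append_assoc] at h
        exact h1 ys t ts' (List.append_inj' h rfl).1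
    · intro h
      refine ⟨fun ys t ts h' => h ys t (ts ++ [a]) (by simp [h']), h xs a [] rfl⟩

theorem ofList_perm {R : Type*} [CommRing R] {xs ys : List R} (h : xs.Perm ys) :
    Ideal.ofList xs = Ideal.ofList ys := by
  simp only [Ideal.ofList, h.mem_iff]

theorem IsSystemOfParameters.perm {R : Type*} [CommRing R] [IsLocalRing R] {xs ys : List R}
    (hx : IsSystemOfParameters xs) (h : xs.Perm ys) : IsSystemOfParameters ys :=
  ⟨h.length_eq ▸ hx.1, ofList_perm h ▸ hx.2⟩

theorem mem_ofList {R : Type*} [CommRing R] {xs : List R} {x : R} (h : x ∈ xs) :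
    x ∈ Ideal.ofList xs :=
  Ideal.subset_span h

theorem IsSystemOfParameters.mem {R : Type*} [CommRing R] [IsLocalRing R] {xs : List R}
    (hx : IsSystemOfParameters xs) {x : R} (h : x ∈ xs) : x ∈ maximalIdeal R :=
  hx.2 ▸ Ideal.le_radical (mem_ofList h)

theorem IsSystemOfParameters.le {R : Type*} [CommRing R] [IsLocalRing R] {xs : List R}
    (hx : IsSystemOfParameters xs) : Ideal.ofList xs ≤ maximalIdeal R :=
  Ideal.span_le.2 fun _ => hx.mem

theorem IsSystemOfParameters.isWeaklyRegular_perm {R : Type*} [CommRing R] [IsLocalRing R]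
    [IsNoetherianRing R] {xs ys : List R} (hx : IsSystemOfParameters xs) (h : xs.Perm ys)
    (hr : IsWeaklyRegular R xs) : IsWeaklyRegular R ys :=
  IsLocalRing.isWeaklyRegular_of_perm_of_subset_maximalIdeal hr h fun _ h' => hx.mem h'

theorem radical_eq_maximalIdeal_iff {R : Type*} [CommRing R] [IsLocalRing R] {I : Ideal R} :
    I.radical = maximalIdeal R ↔ I ≤ maximalIdeal R ∧
      ∀ Q : Ideal R, Q.IsPrime → I ≤ Q → Q = maximalIdeal R := by
  constructor
  · intro h
    refine ⟨h ▸ Ideal.le_radical, fun Q hQ hIQ => le_antisymm (le_maximalIdeal hQ.ne_top) ?_⟩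
    rw [← h]
    exact hQ.radical_le_iff.2 hIQ
  · rintro ⟨h1, h2⟩
    refine le_antisymm ((Ideal.IsPrime.radical_le_iff inferInstance).2 h1) ?_
    rw [Ideal.radical_eq_sInf]
    refine le_sInf fun Q ⟨hIQ, hQ⟩ => (h2 Q hQ hIQ).ge

/-- Two systems of parameters sharing all but one element can be joined through a system of
parameters sharing all but one element with a prescribed third one. -/
theorem exists_cons_isSystemOfParameters {R : Type*} [CommRing R] [IsLocalRing R]
    [IsNoetherianRing R] {a b : R} {xs ys : List R} (hx : IsSystemOfParameters (a :: xs))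
    (hy : IsSystemOfParameters (b :: ys)) :
    ∃ w, IsSystemOfParameters (w :: xs) ∧ IsSystemOfParameters (w :: ys) := by
  have key : ∀ (a : R) (xs : List R), IsSystemOfParameters (a :: xs) →
      (maximalIdeal R ∉ (Ideal.ofList xs).minimalPrimes) ∧
      ∀ w ∈ maximalIdeal R, (∀ Q ∈ (Ideal.ofList xs).minimalPrimes, w ∉ Q) →
        IsSystemOfParameters (w :: xs) := by
    intro a xs h
    constructor
    · intro hm
      have h1 := Ideal.height_le_card_of_mem_minimalPrimes_span (List.finite_toSet xs) hm
      have h2 := h.1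
      rw [← maximalIdeal_height_eq_ringKrullDim] at h2
      have h3 : (maximalIdeal R).height = (xs.length + 1 : ℕ) := by
        exact_mod_cast h2
      rw [h3] at h1
      classical
      have h4 : {x | x ∈ xs}.ncard ≤ xs.length := by
        have : {x | x ∈ xs} = (xs.toFinset : Set R) := by ext; simp
        rw [this, Set.ncard_coe_finset]
        exact xs.toFinset_card_le
      have h5 : xs.length + 1 ≤ {x | x ∈ xs}.ncard := by exact_mod_cast h1
      omega
    · intro w hw hw'
      have hle : Ideal.ofList (w :: xs) ≤ maximalIdeal R := by
        refine Ideal.span_le.2 fun x hx => ?_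
        rcases List.mem_cons.1 hx with rfl | hx
        · exact hw
        · exact h.mem (List.mem_cons_of_mem _ hx)
      refine ⟨by rw [h.1]; rfl, radical_eq_maximalIdeal_iff.2 ⟨hle, fun Q hQ hQ' => ?_⟩⟩
      by_contra hne
      have hlt : Q < maximalIdeal R := lt_of_le_of_ne (le_maximalIdeal hQ.ne_top) hne
      have hxs : {x | x ∈ xs} ⊆ (Q : Set R) := fun x hx =>
        hQ' (mem_ofList (List.mem_cons_of_mem _ hx))
      have hins : insert a {x | x ∈ xs} = {x | x ∈ a :: xs} := by ext; simp
      have := Ideal.mem_minimalPrimes_span_of_mem_minimalPrimes_span_insert hlt a {x | x ∈ xs}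
        (p := maximalIdeal R) (t := {x | x ∈ xs}) (by
          rw [hins]
          have h6 := radical_eq_maximalIdeal_iff.1 h.2
          exact ⟨⟨inferInstance, h6.1⟩, fun P hP _ => (h6.2 P hP.1 hP.2).ge⟩)
        hxs ((Set.subset_insert _ _).trans (Ideal.subset_span.trans Ideal.le_radical))
      exact hw' Q this (hQ' (mem_ofList List.mem_cons_self))
  obtain ⟨hx1, hx2⟩ := key a xs hx
  obtain ⟨hy1, hy2⟩ := key b ys hy
  let S := (Ideal.ofList xs).minimalPrimes ∪ (Ideal.ofList ys).minimalPrimes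
  have hS : S.Finite := (Ideal.finite_minimalPrimes_of_isNoetherianRing R _).union
    (Ideal.finite_minimalPrimes_of_isNoetherianRing R _)
  have hSp : ∀ K ∈ S, K.IsPrime := by
    rintro K (hK | hK)
    · exact hK.1.1
    · exact hK.1.1
  have : ¬ (maximalIdeal R : Set R) ⊆ ⋃ K ∈ hS.toFinset, (K : Set R) := by
    refine (Ideal.subset_union_prime ⊥ ⊥ fun K hK _ _ => hSp K (hS.mem_toFinset.1 hK)).not.2 ?_
    rintro ⟨K, hK, hle⟩
    rw [hS.mem_toFinset] at hK
    have : K = maximalIdeal R := le_antisymm (le_maximalIdeal (hSp K hK).ne_top) hle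
    subst this
    exact hK.elim hx1 hy1
  simp_rw [Set.not_subset, Set.mem_iUnion, not_exists, hS.mem_toFinset] at this
  obtain ⟨w, hw, hw'⟩ := this
  exact ⟨w, hx2 w hw fun Q hQ => hw' Q (Or.inl hQ), hy2 w hw fun Q hQ => hw' Q (Or.inr hQ)⟩

/-- If `J` is proper then the residual quotient `(J : w)` with `w ∉ J` is contained in a prime
ideal of the form `(J : v)`. -/
theorem exists_isPrime_colon_of_notMem {R : Type*} [CommRing R] [IsNoetherianRing R]
    {J : Ideal R} {w : R} (hw : w ∉ J) : ∃ (Q : Ideal R) (v : R), Q.IsPrime ∧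
      (∀ a, a ∈ Q ↔ a * v ∈ J) ∧ ∀ a, a * w ∈ J → a ∈ Q := by
  obtain ⟨Q, hQ, hle⟩ := exists_le_isAssociatedPrime_of_isNoetherianRing R
    (Ideal.Quotient.mk J w) (by rwa [Ne, Ideal.Quotient.eq_zero_iff_mem])
  obtain ⟨hQp, x, rfl⟩ := isAssociatedPrime_iff.1 hQ
  obtain ⟨v, rfl⟩ := Ideal.Quotient.mk_surjective x
  have key : ∀ a u, a ∈ (⊥ : Submodule R (R ⧸ J)).colon {Ideal.Quotient.mk J u} ↔
      a * u ∈ J := by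
    intro a u
    rw [Submodule.mem_colon_singleton, Submodule.mem_bot, ← Ideal.Quotient.eq_zero_iff_mem,
      map_mul]
    rfl
  exact ⟨_, v, hQp, fun a => key a v, fun a ha => hle ((key a w).2 ha)⟩

theorem exists_colon_eq_of_mem_minimalPrimes {R : Type*} [CommRing R] [IsNoetherianRing R]
    {J P : Ideal R} (hP : P ∈ J.minimalPrimes) : ∃ w, ∀ a, a ∈ P ↔ a * w ∈ J := by
  have h := Module.associatedPrimes.minimalPrimes_annihilator_subset_associatedPrimes R (R ⧸ J)
  rw [Ideal.annihilator_quotient] at h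
  obtain ⟨hPp, x, rfl⟩ := isAssociatedPrime_iff.1 (h hP)
  obtain ⟨v, rfl⟩ := Ideal.Quotient.mk_surjective x
  refine ⟨v, fun a => ?_⟩
  rw [Submodule.mem_colon_singleton, Submodule.mem_bot, ← Ideal.Quotient.eq_zero_iff_mem,
      map_mul]
  rfl

theorem mul_mem_ofList_of_isSystemOfParameters {R : Type*} [CommRing R] [IsLocalRing R]
    [IsNoetherianRing R] {a b : R} {xs : List R} (ha : IsSystemOfParameters (a :: xs))
    (hb : IsSystemOfParameters (b :: xs))
    (har : ∀ r, a * r ∈ Ideal.ofList xs → r ∈ Ideal.ofList xs) (r : R)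
    (hr : b * r ∈ Ideal.ofList xs) : r ∈ Ideal.ofList xs := by
  by_contra hr'
  obtain ⟨Q, v, hQ, hQv, hQr⟩ := exists_isPrime_colon_of_notMem hr'
  have hv : v ∉ Ideal.ofList xs := fun h => hQ.ne_top
    ((Ideal.eq_top_iff_one _).2 ((hQv 1).2 (by rwa [one_mul])))
  have hQm : Q = maximalIdeal R := by
    refine (radical_eq_maximalIdeal_iff.1 hb.2).2 Q hQ (Ideal.span_le.2 fun x hx => ?_)
    rcases List.mem_cons.1 hx with rfl | hx
    · exact hQr _ hr
    · exact (hQv x).2 (Ideal.mul_mem_right _ _ (mem_ofList hx))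
  exact hv (har v ((hQv a).1 (hQm ▸ ha.mem List.mem_cons_self)))

theorem IsSystemOfParameters.isWeaklyRegular_append {R : Type*} [CommRing R] [IsLocalRing R]
    [IsNoetherianRing R] (n : ℕ) : ∀ xs ys zs : List R, xs.length = n → ys.length = n →
      IsSystemOfParameters (xs ++ zs) → IsSystemOfParameters (ys ++ zs) →
      IsWeaklyRegular R (xs ++ zs) → IsWeaklyRegular R (ys ++ zs) := by
  have step : ∀ (a b : R) (xs : List R), IsSystemOfParameters (a :: xs) →
      IsSystemOfParameters (b :: xs) → IsWeaklyRegular R (a :: xs) →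
      IsWeaklyRegular R (b :: xs) := by
    intro a b xs ha hb h
    have h1 := ha.isWeaklyRegular_perm (List.perm_append_singleton a xs).symm h
    rw [isWeaklyRegular_append_singleton_iff] at h1
    have hp := List.perm_append_singleton b xs
    refine (hb.perm hp.symm).isWeaklyRegular_perm hp ?_
    rw [isWeaklyRegular_append_singleton_iff]
    exact ⟨h1.1, mul_mem_ofList_of_isSystemOfParameters ha hb h1.2⟩
  induction n with
  | zero =>
    intro xs ys zs hx hy
    obtain rfl := List.length_eq_zero_iff.1 hx
    obtain rfl := List.length_eq_zero_iff.1 hy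
    exact fun _ _ h => h
  | succ n ih =>
    intro xs ys zs hx hy h1 h2 h
    obtain ⟨a, xs, rfl⟩ := List.exists_cons_of_length_eq_add_one hx
    obtain ⟨b, ys, rfl⟩ := List.exists_cons_of_length_eq_add_one hy
    rw [List.cons_append] at h1 h2 h ⊢
    obtain ⟨w, hw1, hw2⟩ := exists_cons_isSystemOfParameters h1 h2
    refine step w b _ hw2 h2 ?_
    have p1 : (xs ++ w :: zs).Perm (w :: (xs ++ zs)) := List.perm_middle
    have p2 : (ys ++ w :: zs).Perm (w :: (ys ++ zs)) := List.perm_middle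
    refine (hw2.perm p2.symm).isWeaklyRegular_perm p2 ?_
    exact ih xs ys (w :: zs) (by simpa using hx) (by simpa using hy) (hw1.perm p1.symm)
      (hw2.perm p2.symm) (hw1.isWeaklyRegular_perm p1.symm (step a w _ h1 hw1 h))

theorem HasRegularSystemsOfParameters.of_isWeaklyRegular {R : Type*} [CommRing R]
    [IsLocalRing R] [IsNoetherianRing R] {xs : List R} (hx : IsSystemOfParameters xs)
    (h : IsWeaklyRegular R xs) : HasRegularSystemsOfParameters R := by
  intro ys t ts hy
  have hlen : (ys ++ t :: ts).length = xs.length := by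
    exact_mod_cast hy.1.symm.trans hx.1
  have := IsSystemOfParameters.isWeaklyRegular_append _ xs (ys ++ t :: ts) [] rfl hlen
    (by simpa using hx) (by simpa using hy) (by simpa using h)
  rw [List.append_nil, isWeaklyRegular_iff_forall_append] at this
  exact this ys t ts rfl

end SystemOfParameters

section HeightsOfParameters

open RingTheory.Sequence

theorem exists_append_le_height {R : Type*} [CommRing R] [IsNoetherianRing R] {I : Ideal R}
    {xs : List R} (hx : xs.length ≤ (Ideal.ofList xs).height) (k : ℕ)
    (hk : (xs.length + k : ℕ) ≤ I.height) : ∃ ts : List R, ts.length = k ∧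
      (∀ t ∈ ts, t ∈ I) ∧ (xs.length + k : ℕ) ≤ (Ideal.ofList (xs ++ ts)).height := by
  induction k with
  | zero => exact ⟨[], rfl, by simp, by simpa using hx⟩
  | succ k ih =>
    obtain ⟨ts, h₁, h₂, h₃⟩ := ih (le_trans (by exact_mod_cast Nat.le_succ _) hk)
    set J := Ideal.ofList (xs ++ ts) with hJ
    set r := xs.length + k with hr
    have hk' : ((r + 1 : ℕ) : ℕ∞) ≤ I.height := hk
    let S := { K | K ∈ J.minimalPrimes ∧ Ideal.height K = r }
    have hS : Set.Finite S := Set.Finite.subset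
      (Ideal.finite_minimalPrimes_of_isNoetherianRing R J) (fun _ h => h.1)
    have : ¬(I : Set R) ⊆ ⋃ K ∈ hS.toFinset, (K : Set R) := by
      refine (Ideal.subset_union_prime ⊥ ⊥ ?_).not.mpr ?_
      · rintro K hK - -
        rw [Set.Finite.mem_toFinset] at hK
        exact hK.1.isPrime
      · push Not
        intro K hK e
        have := hk'.trans (Ideal.height_mono e)
        rw [Set.Finite.mem_toFinset] at hK
        rw [hK.2] at this
        have : r + 1 ≤ r := by exact_mod_cast this
        omega
    simp_rw [Set.not_subset, Set.mem_iUnion, not_exists, Set.Finite.mem_toFinset] at this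
    obtain ⟨x, hx₁, hx₂⟩ := this
    have hJ' : Ideal.ofList (xs ++ (ts ++ [x])) = J ⊔ Ideal.span {x} := by
      rw [← List.append_assoc, Ideal.ofList_append, Ideal.ofList_singleton]
    refine ⟨ts ++ [x], by simp [h₁], ?_, ?_⟩
    · intro t ht
      rcases List.mem_append.1 ht with ht | ht
      · exact h₂ t ht
      · rwa [List.mem_singleton.1 ht]
    · rw [hJ', Ideal.height_eq_inf_minimalPrimes]
      refine le_iInf₂ (fun q hp ↦ ?_)
      have := hp.isPrime
      by_cases h : q.height = ⊤
      · exact le_of_le_of_eq le_top h.symm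
      have : q.FiniteHeight := ⟨Or.inr h⟩
      have := Ideal.height_mono (le_sup_left.trans hp.le)
      suffices h : (r : ℕ∞) ≠ q.height by
        exact Order.add_one_le_of_lt (lt_of_le_of_ne (h₃.trans this) h)
      intro e
      apply hx₂ q
      · exact ⟨Ideal.mem_minimalPrimes_of_height_le (le_sup_left.trans hp.le)
          (e.symm.trans_le h₃), e.symm⟩
      · exact hp.le <| Ideal.mem_sup_right <| Ideal.mem_span_singleton_self x

theorem isSystemOfParameters_of_le_height {R : Type*} [CommRing R] [IsLocalRing R]
    [IsNoetherianRing R] {xs : List R} (hd : ringKrullDim R = xs.length)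
    (hxm : ∀ x ∈ xs, x ∈ maximalIdeal R)
    (hx : xs.length ≤ (Ideal.ofList xs).height) : IsSystemOfParameters xs := by
  refine ⟨hd, radical_eq_maximalIdeal_iff.2 ⟨Ideal.span_le.2 hxm, fun Q hQ hle => ?_⟩⟩
  have hh : (maximalIdeal R).height = xs.length := by
    rw [← maximalIdeal_height_eq_ringKrullDim] at hd
    exact_mod_cast hd
  have hm : maximalIdeal R ∈ (Ideal.ofList xs).minimalPrimes :=
    Ideal.mem_minimalPrimes_of_height_le (Ideal.span_le.2 hxm) (hh ▸ hx)
  exact le_antisymm (le_maximalIdeal hQ.ne_top)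
    (hm.2 ⟨hQ, hle⟩ (le_maximalIdeal hQ.ne_top))

theorem exists_append_isSystemOfParameters {R : Type*} [CommRing R] [IsLocalRing R]
    [IsNoetherianRing R] {xs : List R} (hxm : ∀ x ∈ xs, x ∈ maximalIdeal R)
    (hx : xs.length ≤ (Ideal.ofList xs).height) :
    ∃ ts : List R, IsSystemOfParameters (xs ++ ts) := by
  have hle : Ideal.ofList xs ≤ maximalIdeal R := Ideal.span_le.2 hxm
  have hfin := (Ideal.height_ne_top (IsLocalRing.maximalIdeal.isMaximal R).ne_top :
    (maximalIdeal R).height ≠ ⊤)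
  obtain ⟨d, hd⟩ := ENat.ne_top_iff_exists.1 hfin
  have h1 : xs.length ≤ d := by
    exact_mod_cast hx.trans ((Ideal.height_mono hle).trans hd.ge)
  obtain ⟨k, rfl⟩ := Nat.exists_eq_add_of_le h1
  obtain ⟨ts, h2, h3, h4⟩ := exists_append_le_height hx k hd.le
  have hlen : (xs ++ ts).length = xs.length + k := by simp [h2]
  refine ⟨ts, isSystemOfParameters_of_le_height ?_ ?_ ?_⟩
  · rw [← maximalIdeal_height_eq_ringKrullDim, ← hd, hlen]
    rfl
  · intro x hx
    rcases List.mem_append.1 hx with h | h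
    · exact hxm x h
    · exact h3 x h
  · rwa [hlen]

/-- Unmixedness: an associated prime of an ideal generated by part of a system of parameters has
the expected height. -/
theorem height_le_of_colon {R : Type*} [CommRing R] [IsLocalRing R] [IsNoetherianRing R]
    (hR : HasRegularSystemsOfParameters R) {ys : List R}
    (hy : ys.length ≤ (Ideal.ofList ys).height) {Q : Ideal R} [hQ : Q.IsPrime] {v : R}
    (hv : ∀ a, a ∈ Q ↔ a * v ∈ Ideal.ofList ys) : Q.height ≤ ys.length := by
  by_contra hlt
  have hyQ : ∀ y ∈ ys, y ∈ Q := fun y h => (hv y).2 (Ideal.mul_mem_right _ _ (mem_ofList h))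
  obtain ⟨ts, h1, h2, h3⟩ := exists_append_le_height hy 1
    (Order.add_one_le_of_lt (not_le.1 hlt))
  obtain ⟨t, rfl⟩ := List.length_eq_one_iff.1 h1
  obtain ⟨ts', h4⟩ := exists_append_isSystemOfParameters (xs := ys ++ [t]) (by
    intro x hx
    rcases List.mem_append.1 hx with h | h
    · exact le_maximalIdeal hQ.ne_top (hyQ x h)
    · exact le_maximalIdeal hQ.ne_top (h2 x h)) (by simpa using h3)
  have htQ := (hv t).1 (h2 t (by simp))
  have := hR ys t ts' (by simpa using h4) v htQ
  exact hQ.ne_top ((Ideal.eq_top_iff_one _).2 ((hv 1).2 (by rwa [one_mul])))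

theorem IsSystemOfParameters.forall₂_pow {R : Type*} [CommRing R] [IsLocalRing R]
    {xs ys : List R} (hx : IsSystemOfParameters xs)
    (h : List.Forall₂ (fun x y => ∃ k, 0 < k ∧ y = x ^ k) xs ys) :
    IsSystemOfParameters ys := by
  refine ⟨by rw [hx.1, h.length_eq], ?_⟩
  rw [← hx.2]
  have h1 : ∀ x ∈ xs, ∃ k, x ^ k ∈ Ideal.ofList ys := by
    clear hx
    induction h with
    | nil => simp
    | @cons a b l l' hab _ ih =>
      obtain ⟨k, _, rfl⟩ := hab
      intro x hx
      rcases List.mem_cons.1 hx with rfl | hx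
      · exact ⟨k, mem_ofList List.mem_cons_self⟩
      · obtain ⟨k', hk'⟩ := ih x hx
        exact ⟨k', Ideal.span_mono (fun _ => List.mem_cons_of_mem _) hk'⟩
  have h2 : ∀ y ∈ ys, y ∈ Ideal.ofList xs := by
    clear hx h1
    induction h with
    | nil => simp
    | @cons a b l l' hab _ ih =>
      obtain ⟨k, hk, rfl⟩ := hab
      intro x hx
      rcases List.mem_cons.1 hx with rfl | hx
      · exact Ideal.pow_mem_of_mem _ (mem_ofList List.mem_cons_self) _ hk
      · exact Ideal.span_mono (fun _ => List.mem_cons_of_mem _) (ih x hx)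
  refine le_antisymm (Ideal.radical_mono (Ideal.span_le.2 h2)) ?_
  rw [Ideal.radical_le_radical_iff]
  exact Ideal.span_le.2 h1

theorem le_height_of_forall₂_pow {R : Type*} [CommRing R] {xs ys : List R}
    (hx : xs.length ≤ (Ideal.ofList xs).height)
    (h : List.Forall₂ (fun x y => ∃ k, 0 < k ∧ y = x ^ k) xs ys) :
    ys.length ≤ (Ideal.ofList ys).height := by
  have h1 : ∀ x ∈ xs, ∃ k, x ^ k ∈ Ideal.ofList ys := by
    clear hx
    induction h with
    | nil => simp
    | @cons a b l l' hab _ ih =>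
      obtain ⟨k, _, rfl⟩ := hab
      intro x hx
      rcases List.mem_cons.1 hx with rfl | hx
      · exact ⟨k, mem_ofList List.mem_cons_self⟩
      · obtain ⟨k', hk'⟩ := ih x hx
        exact ⟨k', Ideal.span_mono (fun _ => List.mem_cons_of_mem _) hk'⟩
  rw [← h.length_eq]
  refine hx.trans ?_
  have h2 : (Ideal.ofList ys).radical.height = (Ideal.ofList ys).height := by
    simp only [Ideal.height, Ideal.radical_minimalPrimes]
  rw [← h2]
  exact Ideal.height_mono (Ideal.span_le.2 h1)

theorem forall₂_map_pow {R : Type*} [CommRing R] (xs : List R) {k : ℕ} (hk : 0 < k) :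
    List.Forall₂ (fun x y => ∃ k, 0 < k ∧ y = x ^ k) xs (xs.map (· ^ k)) := by
  rw [List.forall₂_map_right_iff]
  exact List.forall₂_same.2 fun x _ => ⟨k, hk, rfl⟩

theorem forall₂_pow_refl {R : Type*} [CommRing R] (xs : List R) :
    List.Forall₂ (fun x y => ∃ k, 0 < k ∧ y = x ^ k) xs xs :=
  List.forall₂_same.2 fun x _ => ⟨1, one_pos, (pow_one x).symm⟩

variable {R : Type*} [CommRing R] [IsLocalRing R] [IsNoetherianRing R]

omit [IsLocalRing R] in
theorem mem_minimalPrimes_ofList (P : Ideal R) [P.IsPrime] {ys : List R} (hyP : ∀ y ∈ ys, y ∈ P)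
    (hy : ys.length ≤ (Ideal.ofList ys).height) (hP : P.height = ys.length) :
    P ∈ (Ideal.ofList ys).minimalPrimes :=
  Ideal.mem_minimalPrimes_of_height_le (Ideal.span_le.2 hyP) (hP ▸ hy)

omit [IsLocalRing R] in
theorem isSystemOfParameters_map_atPrime (P : Ideal R) [P.IsPrime] {ys : List R}
    (hyP : ∀ y ∈ ys, y ∈ P) (hy : ys.length ≤ (Ideal.ofList ys).height)
    (hP : P.height = ys.length) :
    IsSystemOfParameters (ys.map (algebraMap R (Localization.AtPrime P))) := by
  have hmin := mem_minimalPrimes_ofList P hyP hy hP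
  refine ⟨?_, radical_eq_maximalIdeal_iff.2 ⟨?_, fun Q hQ hle => ?_⟩⟩
  · rw [IsLocalization.AtPrime.ringKrullDim_eq_height P, hP, List.length_map]
    rfl
  · rw [← Ideal.map_ofList, ← Localization.AtPrime.map_eq_maximalIdeal]
    exact Ideal.map_mono hmin.1.2
  · rw [← Ideal.map_ofList, Ideal.map_le_iff_le_comap] at hle
    have hQm := le_maximalIdeal hQ.ne_top
    have h1 : Q.comap (algebraMap R (Localization.AtPrime P)) ≤ P := by
      have := Ideal.comap_mono (f := algebraMap R (Localization.AtPrime P)) hQm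
      rwa [show (maximalIdeal (Localization.AtPrime P)).comap (algebraMap R _) = P from
        Localization.AtPrime.under_maximalIdeal] at this
    have h2 := hmin.2 ⟨Ideal.comap_isPrime _ Q, hle⟩ h1
    refine le_antisymm hQm ?_
    rw [← Localization.AtPrime.map_eq_maximalIdeal]
    exact Ideal.map_le_iff_le_comap.2 h2

theorem HasRegularSystemsOfParameters.atPrime (hR : HasRegularSystemsOfParameters R)
    (P : Ideal R) [P.IsPrime] {ys : List R}
    (hyP : ∀ y ∈ ys, y ∈ P) (hy : ys.length ≤ (Ideal.ofList ys).height)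
    (hP : P.height = ys.length) :
    HasRegularSystemsOfParameters (Localization.AtPrime P) := by
  have : IsNoetherianRing (Localization.AtPrime P) :=
    IsLocalization.isNoetherianRing P.primeCompl _ inferInstance
  refine .of_isWeaklyRegular (isSystemOfParameters_map_atPrime P hyP hy hP) ?_
  obtain ⟨ts, hts⟩ := exists_append_isSystemOfParameters
    (fun y h => le_maximalIdeal (Ideal.IsPrime.ne_top ‹_›) (hyP y h)) hy
  refine IsWeaklyRegular.of_isLocalization _ P.primeCompl ?_
  rw [isWeaklyRegular_iff_forall_append]
  rintro us t us' rfl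
  exact hR us t (us' ++ ts) (by simpa using hts)

end HeightsOfParameters

section FrobeniusPowers

theorem pow_pow_mem_ofList {R : Type*} [CommRing R] (p : ℕ) [Fact p.Prime] [CharP R p]
    {xs : List R} {x : R} (e : ℕ) (hx : x ∈ Ideal.ofList xs) :
    x ^ p ^ e ∈ Ideal.ofList (xs.map (· ^ p ^ e)) := by
  have := Ideal.mem_map_of_mem (iterateFrobenius R p e) hx
  rwa [Ideal.map_ofList] at this

theorem bracketPow_ofList {R : Type*} [CommRing R] (p : ℕ) [Fact p.Prime] [CharP R p]
    (xs : List R) (e : ℕ) :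
    bracketPow (Ideal.ofList xs) (p ^ e) = Ideal.ofList (xs.map (· ^ p ^ e)) :=
  Ideal.map_ofList (iterateFrobenius R p e) xs

theorem mem_ITilde {R : Type*} [CommRing R] {p : ℕ} {I : Ideal R} {c x : R} :
    c ∈ ITilde p I x ↔ ∀ e : ℕ, c * x ^ p ^ e ∈ bracketPow I (p ^ e) := by
  simp only [ITilde, Submodule.mem_iInf]
  refine forall_congr' fun e => ?_
  rw [Ideal.mem_colon_span_singleton]

theorem mem_ITilde_ofList {R : Type*} [CommRing R] {p : ℕ} [Fact p.Prime] [CharP R p]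
    {xs : List R} {c x : R} : c ∈ ITilde p (Ideal.ofList xs) x ↔
      ∀ e : ℕ, c * x ^ p ^ e ∈ Ideal.ofList (xs.map (· ^ p ^ e)) := by
  simp only [mem_ITilde, bracketPow_ofList]

theorem isParameterIdeal_iff {R : Type*} [CommRing R] [IsLocalRing R] {I : Ideal R} :
    IsParameterIdeal I ↔ ∃ xs, IsSystemOfParameters xs ∧ I = Ideal.ofList xs := by
  constructor
  · rintro ⟨n, x, hd, rfl, hr⟩
    have : Ideal.ofList (List.ofFn x) = Ideal.span (Set.range x) := by
      simp only [Ideal.ofList, List.mem_ofFn]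
      rfl
    exact ⟨List.ofFn x, ⟨by simpa using hd, this ▸ hr⟩, this.symm⟩
  · rintro ⟨xs, hx, rfl⟩
    refine ⟨xs.length, xs.get, hx.1, ?_, hx.2⟩
    rw [Set.range_list_get]

theorem mem_span_singleton_sup_iff_of_sub_mem {R : Type*} [CommRing R] {J : Ideal R}
    {a b r : R} (h : b - r * a ∈ J) (hr : ∀ s, r * s ∈ J → s ∈ J) (w : R) :
    w ∈ Ideal.span {a} ⊔ J ↔ r * w ∈ Ideal.span {b} ⊔ J := by
  simp only [Ideal.mem_span_singleton_sup]
  constructor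
  · rintro ⟨s, j, hj, rfl⟩
    exact ⟨s, r * j - s * (b - r * a), J.sub_mem (J.mul_mem_left _ hj) (J.mul_mem_left _ h),
      by ring⟩
  · rintro ⟨s, j, hj, hs⟩
    refine ⟨s, w - s * a, hr _ ?_, by ring⟩
    have : r * (w - s * a) = j + s * (b - r * a) := by linear_combination -hs
    rw [this]
    exact J.add_mem hj (J.mul_mem_left _ h)

variable {R : Type*} [CommRing R] [IsLocalRing R]

theorem HasRegularSystemsOfParameters.cons (hR : HasRegularSystemsOfParameters R) {a : R}
    {xs : List R} (h : IsSystemOfParameters (a :: xs)) (r : R) (hr : a * r ∈ Ideal.ofList xs) :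
    r ∈ Ideal.ofList xs :=
  hR xs a [] (h.perm (List.perm_append_singleton a xs).symm) r hr

variable (p : ℕ) [Fact p.Prime] [CharP R p]

theorem exists_ITilde_cons_eq (hR : HasRegularSystemsOfParameters R) {a b : R} {xs : List R}
    (ha : IsSystemOfParameters (a :: xs)) (hb : IsSystemOfParameters (b :: xs)) (z : R) :
    ∃ k, 0 < k ∧ ∃ z', ITilde p (Ideal.ofList (a :: xs)) z =
      ITilde p (Ideal.ofList (b ^ k :: xs)) z' := by
  have hbm : b ∈ (Ideal.ofList (a :: xs)).radical := ha.2 ▸ hb.mem List.mem_cons_self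
  obtain ⟨k, hk⟩ := hbm
  have hk' : b ^ (k + 1) ∈ Ideal.ofList (a :: xs) := by
    rw [pow_succ]
    exact Ideal.mul_mem_right _ _ hk
  rw [Ideal.ofList_cons, Ideal.mem_span_singleton_sup] at hk'
  obtain ⟨r, c, hc, hrc⟩ := hk'
  refine ⟨k + 1, k.succ_pos, r * z, ?_⟩
  ext c'
  rw [mem_ITilde_ofList, mem_ITilde_ofList]
  refine forall_congr' fun e => ?_
  simp only [List.map_cons, Ideal.ofList_cons]
  have hq : 0 < p ^ e := pow_pos (Fact.out : p.Prime).pos e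
  have hsub : (b ^ (k + 1)) ^ p ^ e - r ^ p ^ e * a ^ p ^ e ∈
      Ideal.ofList (xs.map (· ^ p ^ e)) := by
    have := pow_pow_mem_ofList p e hc
    rwa [← add_sub_cancel_left (r * a) c, hrc, sub_pow_char_pow, mul_pow] at this
  have hreg : ∀ s, r ^ p ^ e * s ∈ Ideal.ofList (xs.map (· ^ p ^ e)) →
      s ∈ Ideal.ofList (xs.map (· ^ p ^ e)) := by
    intro s hs
    refine hR.cons (a := (b ^ (k + 1)) ^ p ^ e) (hb.forall₂_pow
      (.cons ⟨(k + 1) * p ^ e, by positivity, (pow_mul _ _ _).symm⟩ (forall₂_map_pow xs hq)))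
      s ?_
    have : (b ^ (k + 1)) ^ p ^ e * s = ((b ^ (k + 1)) ^ p ^ e - r ^ p ^ e * a ^ p ^ e) * s +
      a ^ p ^ e * (r ^ p ^ e * s) := by ring
    rw [this]
    exact Ideal.add_mem _ (Ideal.mul_mem_right _ _ hsub) (Ideal.mul_mem_left _ _ hs)
  rw [mem_span_singleton_sup_iff_of_sub_mem hsub hreg, mul_pow, mul_left_comm]

theorem exists_ITilde_append_eq [IsNoetherianRing R] (hR : HasRegularSystemsOfParameters R)
    (n : ℕ) : ∀ xs ys zs : List R, xs.length = n → ys.length = n →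
      IsSystemOfParameters (xs ++ zs) → IsSystemOfParameters (ys ++ zs) →
      ∀ z, ∃ vs z', List.Forall₂ (fun x y => ∃ k, 0 < k ∧ y = x ^ k) ys vs ∧
        ITilde p (Ideal.ofList (xs ++ zs)) z = ITilde p (Ideal.ofList (vs ++ zs)) z' := by
  induction n with
  | zero =>
    intro xs ys zs hx hy _ _ z
    obtain rfl := List.length_eq_zero_iff.1 hx
    obtain rfl := List.length_eq_zero_iff.1 hy
    exact ⟨[], z, .nil, rfl⟩
  | succ n ih =>
    intro xs ys zs hx hy h1 h2 z
    obtain ⟨a, xs, rfl⟩ := List.exists_cons_of_length_eq_add_one hx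
    obtain ⟨b, ys, rfl⟩ := List.exists_cons_of_length_eq_add_one hy
    rw [List.cons_append] at h1 h2
    obtain ⟨w, hw1, hw2⟩ := exists_cons_isSystemOfParameters h1 h2
    obtain ⟨k, hk, z₁, hz₁⟩ := exists_ITilde_cons_eq p hR h1 hw1 z
    have p1 : (w ^ k :: (xs ++ zs)).Perm (xs ++ w ^ k :: zs) := List.perm_middle.symm
    have p2 : (w ^ k :: (ys ++ zs)).Perm (ys ++ w ^ k :: zs) := List.perm_middle.symm
    obtain ⟨vs, z₂, hvs, hz₂⟩ := ih xs ys (w ^ k :: zs) (by simpa using hx) (by simpa using hy)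
      ((hw1.forall₂_pow (.cons ⟨k, hk, rfl⟩ (forall₂_pow_refl _))).perm p1)
      ((hw2.forall₂_pow (.cons ⟨k, hk, rfl⟩ (forall₂_pow_refl _))).perm p2) z₁
    have hvz := List.rel_append hvs (forall₂_pow_refl zs)
    obtain ⟨l, hl, z₃, hz₃⟩ := exists_ITilde_cons_eq p hR
      (hw2.forall₂_pow (.cons ⟨k, hk, rfl⟩ hvz))
      (h2.forall₂_pow (.cons ⟨1, one_pos, (pow_one b).symm⟩ hvz)) z₂
    refine ⟨b ^ l :: vs, z₃, .cons ⟨l, hl, rfl⟩ hvs, ?_⟩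
    have p3 : (w ^ k :: (vs ++ zs)).Perm (vs ++ w ^ k :: zs) := List.perm_middle.symm
    rw [List.cons_append, hz₁, ofList_perm p1, hz₂, ← ofList_perm p3, hz₃, List.cons_append]

theorem exists_ITilde_eq_of_isSystemOfParameters [IsNoetherianRing R]
    (hR : HasRegularSystemsOfParameters R) {xs ys : List R} (hx : IsSystemOfParameters xs)
    (hy : IsSystemOfParameters ys) (z : R) :
    ∃ vs z', List.Forall₂ (fun x y => ∃ k, 0 < k ∧ y = x ^ k) ys vs ∧
      ITilde p (Ideal.ofList xs) z = ITilde p (Ideal.ofList vs) z' := by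
  have hlen : ys.length = xs.length := by exact_mod_cast hy.1.symm.trans hx.1
  simpa using exists_ITilde_append_eq p hR _ xs ys [] rfl hlen (by simpa using hx)
    (by simpa using hy) z

end FrobeniusPowers

section LocalToGlobal

theorem map_pow_pow {R : Type*} [CommRing R] (p : ℕ) (xs : List R) (e e' : ℕ) :
    (xs.map (· ^ p ^ e)).map (· ^ p ^ e') = xs.map (· ^ p ^ (e + e')) := by
  simp [← pow_mul, pow_add]

variable (p : ℕ) [Fact p.Prime] {R : Type*} [CommRing R] [CharP R p]
  [IsLocalRing R] [IsNoetherianRing R]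

theorem exists_mem_bSet_of_one_notMem {xs : List R} {z : R} (hx : IsSystemOfParameters xs)
    (hz : (1 : R) ∉ ITilde p (Ideal.ofList xs) z) :
    ∃ Q ∈ bSet p R, ITilde p (Ideal.ofList xs) z ≤ Q := by
  let S : Set (Ideal R) := {A | (∃ xs z, IsSystemOfParameters xs ∧
    A = ITilde p (Ideal.ofList xs) z) ∧ (1 : R) ∉ A ∧ ITilde p (Ideal.ofList xs) z ≤ A}
  obtain ⟨A, ⟨⟨ys, x, hy, hA⟩, hA1, hA2⟩, hmax⟩ := set_has_maximal_iff_noetherian.mpr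
    (inferInstanceAs (IsNoetherian R R)) S ⟨_, ⟨xs, z, hx, rfl⟩, hz, le_rfl⟩
  refine ⟨A, ⟨⟨fun h => hA1 (h ▸ Submodule.mem_top), fun {a b} hab => ?_⟩, _, x,
    isParameterIdeal_iff.2 ⟨ys, hy, rfl⟩, hA⟩, hA2⟩
  rw [or_iff_not_imp_left]
  intro ha
  subst hA
  rw [mem_ITilde_ofList] at ha
  push Not at ha
  obtain ⟨e, he⟩ := ha
  have hp : p.Prime := Fact.out
  let A' := ITilde p (Ideal.ofList (ys.map (· ^ p ^ e))) (a * x ^ p ^ e)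
  have hle : ITilde p (Ideal.ofList ys) x ≤ A' := by
    intro c hc
    rw [mem_ITilde_ofList] at hc ⊢
    intro e'
    rw [map_pow_pow, mul_pow, ← pow_mul, ← pow_add, mul_left_comm]
    exact Ideal.mul_mem_left _ _ (hc _)
  have h1 : (1 : R) ∉ A' := by
    intro h
    have := mem_ITilde_ofList.1 h 0
    simp only [pow_zero, pow_one, one_mul, List.map_id'] at this
    exact he this
  have hA' : A' ∈ S := ⟨⟨_, _, hy.forall₂_pow (forall₂_map_pow ys (pow_pos hp.pos e)), rfl⟩,
    h1, hA2.trans hle⟩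
  have hb : b ∈ A' := by
    rw [mem_ITilde_ofList] at hab ⊢
    intro e'
    rw [map_pow_pow, mul_pow, ← pow_mul, ← pow_add]
    obtain ⟨q, hq⟩ := Nat.exists_eq_succ_of_ne_zero (pow_pos hp.pos e').ne'
    have : b * (a ^ p ^ e' * x ^ p ^ (e + e')) =
        a ^ q * (a * b * x ^ p ^ (e + e')) := by
      rw [hq, pow_succ]; ring
    rw [this]
    exact Ideal.mul_mem_left _ _ (hab _)
  rwa [← eq_of_le_of_not_lt hle (hmax A' hA')] at hb

theorem mem_of_forall_mem_sup_pow {J : Ideal R} {x : R}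
    (h : ∀ n, x ∈ J ⊔ maximalIdeal R ^ n) : x ∈ J := by
  have h1 := Ideal.iInf_pow_smul_eq_bot_of_isLocalRing (M := R ⧸ J) (maximalIdeal R)
    (maximalIdeal.isMaximal R).ne_top
  have h2 : Ideal.Quotient.mk J x ∈ (⊥ : Submodule R (R ⧸ J)) := by
    rw [← h1, Submodule.mem_iInf]
    intro n
    obtain ⟨j, hj, y, hy, hxy⟩ := Submodule.mem_sup.1 (h n)
    rw [← hxy, map_add, Ideal.Quotient.eq_zero_iff_mem.2 hj, zero_add]
    have := Submodule.smul_mem_smul hy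
      (Submodule.mem_top (x := (1 : R ⧸ J)) (R := R))
    rwa [← Algebra.algebraMap_eq_smul_one] at this
  rwa [Submodule.mem_bot, Ideal.Quotient.eq_zero_iff_mem] at h2

omit [IsNoetherianRing R] in
theorem ofList_append_map_pow_le {ys ts : List R} (ht : ∀ t ∈ ts, t ∈ maximalIdeal R) (n : ℕ) :
    Ideal.ofList (ys ++ ts.map (· ^ n)) ≤ Ideal.ofList ys ⊔ maximalIdeal R ^ n := by
  rw [Ideal.ofList_append]
  refine sup_le_sup_left (Ideal.span_le.2 fun x hx => ?_) _
  obtain ⟨t, h, rfl⟩ := List.mem_map.1 hx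
  exact Ideal.pow_mem_pow (ht t h) n

omit [IsLocalRing R] in
theorem exists_mul_mem_of_mem_map_atPrime (I P : Ideal R) [P.IsPrime] :
    ∃ s ∉ P, ∀ x, algebraMap R (Localization.AtPrime P) x ∈
      I.map (algebraMap R (Localization.AtPrime P)) → s * x ∈ I := by
  have key : ∀ K : Ideal R, K.FG → (∀ x ∈ K, ∃ s ∉ P, s * x ∈ I) →
      ∃ s ∉ P, ∀ x ∈ K, s * x ∈ I := by
    intro K hK
    induction K, hK using Submodule.fg_induction with
    | singleton x =>
      intro h
      obtain ⟨s, hs, hsx⟩ := h x (Submodule.mem_span_singleton_self x)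
      refine ⟨s, hs, fun y hy => ?_⟩
      obtain ⟨a, rfl⟩ := Submodule.mem_span_singleton.1 hy
      rw [smul_eq_mul, mul_left_comm]
      exact I.mul_mem_left _ hsx
    | sup K₁ K₂ _ _ h₁ h₂ =>
      intro h
      obtain ⟨s, hs, hs'⟩ := h₁ fun x hx => h x (Submodule.mem_sup_left hx)
      obtain ⟨t, ht, ht'⟩ := h₂ fun x hx => h x (Submodule.mem_sup_right hx)
      refine ⟨s * t, fun hst => (Ideal.IsPrime.mem_or_mem ‹_› hst).elim hs ht, fun x hx => ?_⟩
      obtain ⟨y, hy, z, hz, rfl⟩ := Submodule.mem_sup.1 hx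
      have : s * t * (y + z) = t * (s * y) + s * (t * z) := by ring
      rw [this]
      exact I.add_mem (I.mul_mem_left _ (hs' y hy)) (I.mul_mem_left _ (ht' z hz))
  obtain ⟨s, hs, h⟩ := key
    ((I.map (algebraMap R (Localization.AtPrime P))).comap (algebraMap R _))
    (IsNoetherian.noetherian _) fun x hx => by
      obtain ⟨m, hm, hmx⟩ := (IsLocalization.algebraMap_mem_map_algebraMap_iff P.primeCompl
        _ I x).1 hx
      exact ⟨m, hm, hmx⟩
  exact ⟨s, hs, h⟩

omit [IsLocalRing R] [IsNoetherianRing R] in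
theorem charP_localization_atPrime (P : Ideal R) [P.IsPrime] :
    CharP (Localization.AtPrime P) p := by
  let _ : Algebra (ZMod p) R := ZMod.algebra R p
  exact charP_of_injective_algebraMap
    (algebraMap (ZMod p) (Localization.AtPrime P)).injective p

omit [IsLocalRing R] [IsNoetherianRing R] in
theorem notMem_of_one_notMem_ITilde {xs : List R} {z : R}
    (h : (1 : R) ∉ ITilde p (Ideal.ofList xs) z) : z ∉ Ideal.ofList xs := by
  intro hz
  refine h (mem_ITilde_ofList.2 fun e => ?_)
  rw [one_mul]
  exact pow_pow_mem_ofList p e hz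

theorem exists_le_mem_bSet_of_ITilde_atPrime (hR : HasRegularSystemsOfParameters R)
    (P : Ideal R) [P.IsPrime] {ys : List R} (hyP : ∀ y ∈ ys, y ∈ P)
    (hy : ys.length ≤ (Ideal.ofList ys).height) (hP : P.height = ys.length)
    (x : Localization.AtPrime P)
    (hx : ITilde p (Ideal.ofList (ys.map (algebraMap R (Localization.AtPrime P)))) x =
      maximalIdeal (Localization.AtPrime P)) : ∃ Q ∈ bSet p R, P ≤ Q := by
  have hp : p.Prime := Fact.out
  have := charP_localization_atPrime p P
  have : IsNoetherianRing (Localization.AtPrime P) :=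
    IsLocalization.isNoetherianRing P.primeCompl _ inferInstance
  obtain ⟨z, u, rfl⟩ := IsLocalization.exists_mk'_eq P.primeCompl x
  have hzu := IsLocalization.mk'_spec (Localization.AtPrime P) z u
  have hsop := isSystemOfParameters_map_atPrime P hyP hy hP
  set x := IsLocalization.mk' (Localization.AtPrime P) z u
  set f := algebraMap R (Localization.AtPrime P)
  have hx1 : x ∉ Ideal.ofList (ys.map f) := notMem_of_one_notMem_ITilde p
    (hx ▸ fun h => (maximalIdeal.isMaximal _).ne_top ((Ideal.eq_top_iff_one _).2 h))
  have hz1 : f z ∉ Ideal.ofList (ys.map f) := by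
    rw [← hzu]
    intro h
    exact hx1 ((Ideal.mul_unit_mem_iff_mem _ (IsLocalization.map_units _ u)).1 h)
  have hmap : ∀ e : ℕ, (ys.map f).map (· ^ p ^ e) = (ys.map (· ^ p ^ e)).map f := by
    intro e; simp
  have hz2 : ∀ a ∈ P, ∀ e : ℕ, ∃ m ∉ P, m * (a * z ^ p ^ e) ∈
      Ideal.ofList (ys.map (· ^ p ^ e)) := by
    intro a ha e
    have h1 : f a ∈ ITilde p (Ideal.ofList (ys.map f)) x := by
      rw [hx, ← Localization.AtPrime.map_eq_maximalIdeal]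
      exact Ideal.mem_map_of_mem _ ha
    have h2 := mem_ITilde_ofList.1 h1 e
    have h3 : f (a * z ^ p ^ e) ∈ (Ideal.ofList (ys.map (· ^ p ^ e))).map f := by
      rw [Ideal.map_ofList, ← hmap, map_mul, map_pow, ← hzu, mul_pow, ← mul_assoc]
      exact Ideal.mul_mem_right _ _ h2
    obtain ⟨m, hm, h4⟩ := (IsLocalization.algebraMap_mem_map_algebraMap_iff P.primeCompl
      _ _ _).1 h3
    exact ⟨m, hm, h4⟩
  obtain ⟨s, hs, hs'⟩ := exists_mul_mem_of_mem_map_atPrime (Ideal.ofList ys) P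
  have hPz : ∀ a ∈ P, ∀ e : ℕ, a * (s * z) ^ p ^ e ∈ Ideal.ofList (ys.map (· ^ p ^ e)) := by
    intro a ha e
    by_contra hw
    obtain ⟨Q, v, hQ, hQv, hQw⟩ := exists_isPrime_colon_of_notMem hw
    have hpow := forall₂_map_pow ys (pow_pos hp.pos e)
    have hht := height_le_of_colon hR (le_height_of_forall₂_pow hy hpow) hQv
    rw [← hpow.length_eq, ← hP] at hht
    by_cases hPQ : P ≤ Q
    · have hPQ' : P = Q := by
        by_contra hne
        exact absurd hht (not_le.2
          (Ideal.height_strict_mono_of_isPrime_of_isPrime (lt_of_le_of_ne hPQ hne)))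
      obtain ⟨m, hm, hm'⟩ := hz2 a ha e
      refine hm (hPQ'.symm ▸ hQw m ?_)
      rw [mul_pow, mul_left_comm a, mul_left_comm m]
      exact Ideal.mul_mem_left _ _ hm'
    · obtain ⟨r, hr, hrQ⟩ := Set.not_subset.1 hPQ
      have h1 : f r ∈ (Ideal.ofList (ys.map f)).radical := by
        rw [hsop.2, ← Localization.AtPrime.map_eq_maximalIdeal]
        exact Ideal.mem_map_of_mem _ hr
      obtain ⟨N, hN⟩ := h1
      rw [← map_pow, ← Ideal.map_ofList] at hN
      have h2 := pow_pow_mem_ofList p e (hs' _ hN)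
      refine hrQ (hQ.mem_of_pow_mem N (hQ.mem_of_pow_mem (p ^ e) (hQw _ ?_)))
      have : (r ^ N) ^ p ^ e * (a * (s * z) ^ p ^ e) =
          a * z ^ p ^ e * (s * r ^ N) ^ p ^ e := by ring
      rw [this]
      exact Ideal.mul_mem_left _ _ h2
  have hsz : s * z ∉ Ideal.ofList ys := by
    intro h
    have h1 := Ideal.mem_map_of_mem f h
    rw [Ideal.map_ofList, map_mul, mul_comm] at h1
    exact hz1 ((Ideal.mul_unit_mem_iff_mem _
      (IsLocalization.map_units (Localization.AtPrime P) (⟨s, hs⟩ : P.primeCompl))).1 h1)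
  obtain ⟨ts, hts⟩ := exists_append_isSystemOfParameters
    (fun y h => le_maximalIdeal (Ideal.IsPrime.ne_top ‹_›) (hyP y h)) hy
  have htm : ∀ t ∈ ts, t ∈ maximalIdeal R := fun t h => hts.mem (List.mem_append_right _ h)
  obtain ⟨n, hn, hn'⟩ : ∃ n, 0 < n ∧ s * z ∉ Ideal.ofList (ys ++ ts.map (· ^ n)) := by
    by_contra! h
    refine hsz (mem_of_forall_mem_sup_pow fun n => ?_)
    have hle : Ideal.ofList ys ⊔ maximalIdeal R ^ (n + 1) ≤
        Ideal.ofList ys ⊔ maximalIdeal R ^ n :=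
      sup_le_sup_left (Ideal.pow_le_pow_right n.le_succ) _
    exact hle (ofList_append_map_pow_le htm _ (h (n + 1) n.succ_pos))
  have hsopn : IsSystemOfParameters (ys ++ ts.map (· ^ n)) :=
    hts.forall₂_pow (List.rel_append (forall₂_pow_refl ys) (forall₂_map_pow ts hn))
  obtain ⟨Q, hQ, hle⟩ := exists_mem_bSet_of_one_notMem p (z := s * z) hsopn fun h => by
    have := mem_ITilde_ofList.1 h 0
    simp only [pow_zero, pow_one, one_mul, List.map_id'] at this
    exact hn' this
  refine ⟨Q, hQ, le_trans (fun a ha => mem_ITilde_ofList.2 fun e => ?_) hle⟩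
  rw [List.map_append, Ideal.ofList_append]
  exact Ideal.mem_sup_left (hPz a ha e)

omit [IsLocalRing R] [IsNoetherianRing R] in
theorem exists_map_eq_of_forall₂_pow {S : Type*} [CommRing S] (f : R →+* S) {ys : List R}
    {vs : List S} (h : List.Forall₂ (fun x y => ∃ k, 0 < k ∧ y = x ^ k) (ys.map f) vs) :
    ∃ us, vs = us.map f ∧ List.Forall₂ (fun x y => ∃ k, 0 < k ∧ y = x ^ k) ys us := by
  induction ys generalizing vs with
  | nil => exact ⟨[], by simpa using h, .nil⟩
  | cons y ys ih =>
    rw [List.map_cons, List.forall₂_cons_left_iff] at h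
    obtain ⟨b, vs, ⟨k, hk, rfl⟩, h, rfl⟩ := h
    obtain ⟨us, rfl, hus⟩ := ih h
    exact ⟨y ^ k :: us, by simp, .cons ⟨k, hk, rfl⟩ hus⟩

omit [IsLocalRing R] [IsNoetherianRing R] in
theorem mem_of_forall₂_pow {P : Ideal R} {ys us : List R}
    (h : List.Forall₂ (fun x y => ∃ k, 0 < k ∧ y = x ^ k) ys us) (hy : ∀ y ∈ ys, y ∈ P) :
    ∀ u ∈ us, u ∈ P := by
  induction h with
  | nil => simp
  | @cons a b l l' hab _ ih =>
    obtain ⟨k, hk, rfl⟩ := hab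
    intro u hu
    rcases List.mem_cons.1 hu with rfl | hu
    · exact P.pow_mem_of_mem (hy a List.mem_cons_self) _ hk
    · exact ih (fun y h => hy y (List.mem_cons_of_mem _ h)) u hu

theorem exists_parameters_of_prime (P : Ideal R) [P.IsPrime] : ∃ ys : List R,
    (∀ y ∈ ys, y ∈ P) ∧ ys.length ≤ (Ideal.ofList ys).height ∧ P.height = ys.length := by
  obtain ⟨h, hh⟩ := ENat.ne_top_iff_exists.1 (Ideal.height_ne_top (I := P) (Ideal.IsPrime.ne_top ‹_›))
  obtain ⟨ys, h1, h2, h3⟩ := exists_append_le_height (I := P) (xs := []) (by simp) h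
    (by simp [hh])
  refine ⟨ys, h2, ?_, ?_⟩
  · simpa [h1] using h3
  · rw [h1, hh]

theorem exists_le_mem_bSet_of_mem_aSet (hR : HasRegularSystemsOfParameters R) {P : Ideal R}
    (hPA : P ∈ aSet p R) : ∃ Q ∈ bSet p R, P ≤ Q := by
  obtain ⟨hPp, J, x, hJ, hx⟩ := hPA
  obtain ⟨ys, hyP, hy, hP⟩ := exists_parameters_of_prime P
  have := charP_localization_atPrime p P
  have : IsNoetherianRing (Localization.AtPrime P) :=
    IsLocalization.isNoetherianRing P.primeCompl _ inferInstance
  obtain ⟨xs, hxs, rfl⟩ := isParameterIdeal_iff.1 hJ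
  obtain ⟨vs, z, hvs, hz⟩ := exists_ITilde_eq_of_isSystemOfParameters p
    (hR.atPrime P hyP hy hP) hxs (isSystemOfParameters_map_atPrime P hyP hy hP) x
  obtain ⟨us, rfl, hus⟩ := exists_map_eq_of_forall₂_pow _ hvs
  exact exists_le_mem_bSet_of_ITilde_atPrime p hR P (mem_of_forall₂_pow hus hyP)
    (le_height_of_forall₂_pow hy hus) (by rw [hP, hus.length_eq]) z (by rw [← hz, hx])

end LocalToGlobal

section Colon

theorem exists_append_of_forall₂_append {α β : Type*} {r : α → β → Prop} {l₁ l₂ : List α} :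
    ∀ {vs : List β}, List.Forall₂ r (l₁ ++ l₂) vs →
      ∃ us ws, vs = us ++ ws ∧ List.Forall₂ r l₁ us ∧ List.Forall₂ r l₂ ws := by
  induction l₁ with
  | nil => exact fun h => ⟨[], _, rfl, .nil, h⟩
  | cons a l₁ ih =>
    intro vs h
    obtain ⟨b, vs, hab, h', rfl⟩ := List.forall₂_cons_left_iff.1 h
    obtain ⟨us, ws, rfl, h1, h2⟩ := ih h'
    exact ⟨b :: us, ws, rfl, .cons hab h1, h2⟩

theorem prod_map_pow {R : Type*} [CommMonoid R] (xs : List R) (n : ℕ) :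
    (xs.map (· ^ n)).prod = xs.prod ^ n := by
  induction xs with
  | nil => simp
  | cons x xs ih => simp [mul_pow, ih]

theorem mul_mem_of_mem_ofList {R : Type*} [CommRing R] {xs : List R} {I : Ideal R} {w : R}
    (h : ∀ x ∈ xs, x * w ∈ I) {r : R} (hr : r ∈ Ideal.ofList xs) : r * w ∈ I := by
  induction hr using Submodule.span_induction with
  | mem x hx => exact h x hx
  | zero => simp
  | add x y _ _ hx hy => rw [add_mul]; exact I.add_mem hx hy
  | smul a x _ hx => rw [smul_mul_assoc]; exact I.mul_mem_left _ hx

theorem mul_prod_pow_mem_ofList {R : Type*} [CommRing R] {xs ts : List R} {a b : ℕ} {r : R}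
    (hr : r ∈ Ideal.ofList (xs ++ ts.map (· ^ a))) :
    r * ts.prod ^ b ∈ Ideal.ofList (xs ++ ts.map (· ^ (a + b))) := by
  refine mul_mem_of_mem_ofList (fun x hx => ?_) hr
  rcases List.mem_append.1 hx with h | h
  · exact Ideal.mul_mem_right _ _ (mem_ofList (List.mem_append_left _ h))
  · obtain ⟨t, ht, rfl⟩ := List.mem_map.1 h
    obtain ⟨c, hc⟩ := List.dvd_prod ht
    have : t ^ a * ts.prod ^ b = c ^ b * t ^ (a + b) := by rw [hc]; ring
    rw [this]
    exact Ideal.mul_mem_left _ _ (mem_ofList (List.mem_append_right _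
      (List.mem_map.2 ⟨t, ht, rfl⟩)))

variable {R : Type*} [CommRing R] [IsLocalRing R]

theorem HasRegularSystemsOfParameters.mem_of_mul_pow_mem
    (hR : HasRegularSystemsOfParameters R) {t : R} {xs : List R}
    (h : IsSystemOfParameters (t :: xs)) {a b : ℕ} {r : R}
    (hr : r * t ^ b ∈ Ideal.ofList (t ^ (a + b) :: xs)) : r ∈ Ideal.ofList (t ^ a :: xs) := by
  rw [Ideal.ofList_cons, Ideal.mem_span_singleton_sup] at hr ⊢
  obtain ⟨c, j, hj, hcj⟩ := hr
  refine ⟨c, r - c * t ^ a, ?_, by ring⟩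
  have h1 : t ^ b * (r - c * t ^ a) ∈ Ideal.ofList xs := by
    have : t ^ b * (r - c * t ^ a) = j := by
      rw [pow_add] at hcj
      linear_combination -hcj
    rwa [this]
  rcases Nat.eq_zero_or_pos b with rfl | hb
  · simpa using h1
  · exact hR.cons (h.forall₂_pow (.cons ⟨b, hb, rfl⟩ (forall₂_pow_refl xs))) _ h1

theorem HasRegularSystemsOfParameters.mem_of_mul_prod_pow_mem
    (hR : HasRegularSystemsOfParameters R) {ts : List R} {a : ℕ} (ha : 0 < a) (b : ℕ) :
    ∀ {xs : List R} {r : R}, IsSystemOfParameters (xs ++ ts) →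
      r * ts.prod ^ b ∈ Ideal.ofList (xs ++ ts.map (· ^ (a + b))) →
      r ∈ Ideal.ofList (xs ++ ts.map (· ^ a)) := by
  induction ts with
  | nil => intro xs r _ h; simpa using h
  | cons t ts ih =>
    intro xs r h hr
    rw [List.map_cons] at hr ⊢
    have h1 : IsSystemOfParameters ((xs ++ [t ^ (a + b)]) ++ ts) := by
      rw [List.append_assoc]
      exact h.forall₂_pow (List.rel_append (forall₂_pow_refl xs)
        (.cons ⟨a + b, by omega, rfl⟩ (forall₂_pow_refl ts)))
    have h2 := ih (r := r * t ^ b) h1 (by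
      rw [List.prod_cons, mul_pow, ← mul_assoc] at hr
      simpa using hr)
    have h3 : IsSystemOfParameters (t :: (xs ++ ts.map (· ^ a))) :=
      (h.perm List.perm_middle).forall₂_pow (.cons ⟨1, one_pos, (pow_one t).symm⟩
        (List.rel_append (forall₂_pow_refl xs) (forall₂_map_pow ts ha)))
    rw [ofList_perm (List.perm_middle (a := t ^ a))]
    refine hR.mem_of_mul_pow_mem h3 (b := b) ?_
    rw [← ofList_perm (List.perm_middle (a := t ^ (a + b)))]
    simpa using h2

theorem HasRegularSystemsOfParameters.mul_prod_mem_iff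
    (hR : HasRegularSystemsOfParameters R) {xs ts : List R}
    (h : IsSystemOfParameters (xs ++ ts)) (n : ℕ) (r : R) :
    r * ts.prod ∈ Ideal.ofList (xs ++ ts.map (· ^ (n + 1 + 1))) ↔
      r ∈ Ideal.ofList (xs ++ ts.map (· ^ (n + 1))) :=
  ⟨fun hr => hR.mem_of_mul_prod_pow_mem n.succ_pos 1 h (by rwa [pow_one]),
    fun hr => by simpa using mul_prod_pow_mem_ofList (b := 1) hr⟩

theorem HasRegularSystemsOfParameters.mem_span_prod_sup
    (hR : HasRegularSystemsOfParameters R) {ts : List R} {n k : ℕ} (hn : 0 < n) :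
    ∀ {xs : List R} {r : R}, IsSystemOfParameters (xs ++ ts) →
      (∀ t ∈ ts, t ^ n * r ∈ Ideal.ofList (xs ++ ts.map (· ^ (n + k)))) →
      ∃ c, r - c * ts.prod ^ k ∈ Ideal.ofList (xs ++ ts.map (· ^ (n + k))) := by
  induction ts with
  | nil => intro xs r _ _; exact ⟨r, by simp⟩
  | cons t ts ih =>
    intro xs r h hr
    rw [List.map_cons] at hr ⊢
    set L := xs ++ t ^ (n + k) :: ts.map (· ^ (n + k)) with hL
    have hL' : L = (xs ++ [t ^ (n + k)]) ++ ts.map (· ^ (n + k)) := by simp [hL]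
    have h1 : IsSystemOfParameters ((xs ++ [t ^ (n + k)]) ++ ts) := by
      rw [List.append_assoc]
      exact h.forall₂_pow (List.rel_append (forall₂_pow_refl xs)
        (.cons ⟨n + k, by omega, rfl⟩ (forall₂_pow_refl ts)))
    obtain ⟨c, hc⟩ := ih h1 fun t' ht' => by
      rw [← hL']
      exact hr t' (List.mem_cons_of_mem _ ht')
    have h2 : t ^ n * c * ts.prod ^ k ∈ Ideal.ofList L := by
      have : t ^ n * c * ts.prod ^ k = t ^ n * r - t ^ n * (r - c * ts.prod ^ k) := by ring
      rw [this]
      exact Ideal.sub_mem _ (hr t List.mem_cons_self)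
        (Ideal.mul_mem_left _ _ (by rw [hL']; exact hc))
    rw [hL'] at h2
    have h3 := hR.mem_of_mul_prod_pow_mem hn k h1 h2
    have h4 : IsSystemOfParameters (t :: (xs ++ ts.map (· ^ n))) :=
      (h.perm List.perm_middle).forall₂_pow (.cons ⟨1, one_pos, (pow_one t).symm⟩
        (List.rel_append (forall₂_pow_refl xs) (forall₂_map_pow ts hn)))
    have h5 : c ∈ Ideal.ofList (t ^ k :: (xs ++ ts.map (· ^ n))) := by
      refine hR.mem_of_mul_pow_mem h4 (b := n) ?_
      rw [← ofList_perm (List.perm_middle (a := t ^ (k + n))), add_comm k n, mul_comm]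
      simpa using h3
    rw [Ideal.ofList_cons, Ideal.mem_span_singleton_sup] at h5
    obtain ⟨d, j, hj, rfl⟩ := h5
    refine ⟨d, ?_⟩
    have h6 := mul_prod_pow_mem_ofList (b := k) hj
    have h7 : Ideal.ofList (xs ++ ts.map (· ^ (n + k))) ≤ Ideal.ofList L := by
      refine Ideal.span_mono fun x hx => ?_
      rcases List.mem_append.1 hx with hx | hx
      · exact List.mem_append_left _ hx
      · exact List.mem_append_right _ (List.mem_cons_of_mem _ hx)
    have : r - d * (t :: ts).prod ^ k = (r - (d * t ^ k + j) * ts.prod ^ k) +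
        j * ts.prod ^ k := by
      rw [List.prod_cons]; ring
    rw [this]
    exact Ideal.add_mem _ (by rw [hL']; exact hc) (h7 h6)

end Colon

section GlobalToLocal

variable (p : ℕ) [Fact p.Prime] {R : Type*} [CommRing R] [CharP R p]

/-- The ideal of all elements `r` with `P ≤ ITilde p (Ideal.ofList xs) r`. -/
def frobeniusColon (P : Ideal R) (xs : List R) : Ideal R where
  carrier := {r | ∀ a ∈ P, ∀ e : ℕ, a * r ^ p ^ e ∈ Ideal.ofList (xs.map (· ^ p ^ e))}
  add_mem' {r s} hr hs a ha e := by
    rw [add_pow_char_pow, mul_add]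
    exact Ideal.add_mem _ (hr a ha e) (hs a ha e)
  zero_mem' a _ e := by
    rw [zero_pow (pow_pos (Fact.out : p.Prime).pos e).ne', mul_zero]
    exact Ideal.zero_mem _
  smul_mem' c r hr a ha e := by
    rw [smul_eq_mul, mul_pow, mul_left_comm]
    exact Ideal.mul_mem_left _ _ (hr a ha e)

theorem mem_frobeniusColon {P : Ideal R} {xs : List R} {r : R} :
    r ∈ frobeniusColon p P xs ↔
      ∀ a ∈ P, ∀ e : ℕ, a * r ^ p ^ e ∈ Ideal.ofList (xs.map (· ^ p ^ e)) :=
  Iff.rfl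

theorem ofList_le_frobeniusColon (P : Ideal R) (xs : List R) :
    Ideal.ofList xs ≤ frobeniusColon p P xs :=
  fun _ hr _ _ e => Ideal.mul_mem_left _ _ (pow_pow_mem_ofList p e hr)

variable [IsLocalRing R]

omit [CharP R p] in
theorem IsSystemOfParameters.map_pow {xs : List R} (h : IsSystemOfParameters xs) (e : ℕ) :
    IsSystemOfParameters (xs.map (· ^ p ^ e)) :=
  h.forall₂_pow (forall₂_map_pow xs (pow_pos (Fact.out : p.Prime).pos e))

theorem mul_prod_mem_frobeniusColon_iff (hR : HasRegularSystemsOfParameters R) {ys ts : List R}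
    (h : IsSystemOfParameters (ys ++ ts)) (P : Ideal R) (n : ℕ) (r : R) :
    r * ts.prod ∈ frobeniusColon p P (ys ++ ts.map (· ^ (n + 1 + 1))) ↔
      r ∈ frobeniusColon p P (ys ++ ts.map (· ^ (n + 1))) := by
  rw [mem_frobeniusColon, mem_frobeniusColon]
  refine forall_congr' fun a => forall_congr' fun _ => forall_congr' fun e => ?_
  have h1 : ∀ k : ℕ, (ys ++ ts.map (· ^ k)).map (· ^ p ^ e) =
      ys.map (· ^ p ^ e) ++ (ts.map (· ^ p ^ e)).map (· ^ k) := by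
    intro k
    simp [pow_right_comm]
  have h2 : ts.prod ^ p ^ e = (ts.map (· ^ p ^ e)).prod := (prod_map_pow ..).symm
  have h3 := h.map_pow p e
  rw [List.map_append] at h3
  rw [h1, h1, mul_pow, ← mul_assoc, h2]
  exact hR.mul_prod_mem_iff h3 n _

theorem exists_mem_frobeniusColon_mul_notMem (hR : HasRegularSystemsOfParameters R)
    {ys ts : List R} (h : IsSystemOfParameters (ys ++ ts)) {P : Ideal R}
    (hyP : ∀ y ∈ ys, y ∈ P) {z : R} (hPz : P = ITilde p (Ideal.ofList (ys ++ ts)) z) {s : R}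
    (hs : s ∉ P) : ∃ n, ∃ r ∈ frobeniusColon p P (ys ++ ts.map (· ^ (n + 1))),
      s * r ∉ Ideal.ofList (ys ++ ts.map (· ^ (n + 1))) := by
  have hs' := hs
  rw [hPz, mem_ITilde_ofList] at hs'
  push Not at hs'
  obtain ⟨e, he⟩ := hs'
  obtain ⟨n, hn⟩ := Nat.exists_eq_succ_of_ne_zero (pow_pos (Fact.out : p.Prime).pos e).ne'
  have hperm : ∀ L L' : List R, Ideal.ofList (L ++ L') = Ideal.ofList (L' ++ L) :=
    fun L L' => ofList_perm List.perm_append_comm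
  have hq : p ^ e = 1 + n := by omega
  have hq' : p ^ e = n + 1 := hn
  have hzP : ∀ a ∈ P, ∀ e : ℕ, a * z ^ p ^ e ∈ Ideal.ofList ((ys ++ ts).map (· ^ p ^ e)) :=
    fun a ha => mem_ITilde_ofList.1 (hPz ▸ ha)
  have h1 : IsSystemOfParameters (ts.map (· ^ p ^ e) ++ ys) :=
    (h.perm List.perm_append_comm).forall₂_pow (List.rel_append
      (forall₂_map_pow ts (by omega)) (forall₂_pow_refl ys))
  obtain ⟨c, hc⟩ := hR.mem_span_prod_sup (n := 1) (k := n) (r := z ^ p ^ e) one_pos h1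
    fun y hy => by
      have := hzP y (hyP y hy) e
      rw [List.map_append, hperm] at this
      rw [pow_one, ← hq]
      exact this
  refine ⟨n, c, fun a ha e' => ?_, fun hsc => he ?_⟩
  · have h2 := hzP a ha (e + e')
    have h3 := pow_pow_mem_ofList p e' hc
    rw [sub_pow_char_pow, ← pow_mul, ← pow_add, ← hq, List.map_append, map_pow_pow,
      map_pow_pow] at h3
    rw [List.map_append, hperm] at h2
    have h4 : a * c ^ p ^ e' * ((ys.map (· ^ p ^ e')).prod) ^ n ∈
        Ideal.ofList (ts.map (· ^ p ^ (e + e')) ++ (ys.map (· ^ p ^ e')).map (· ^ (1 + n))) := by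
      rw [← hq, map_pow_pow, add_comm e' e, prod_map_pow]
      have : a * c ^ p ^ e' * (ys.prod ^ p ^ e') ^ n = a * z ^ p ^ (e + e') -
          a * (z ^ p ^ (e + e') - (c * ys.prod ^ n) ^ p ^ e') := by ring
      rw [this]
      exact Ideal.sub_mem _ h2 (Ideal.mul_mem_left _ _ h3)
    have h5 : IsSystemOfParameters (ts.map (· ^ p ^ (e + e')) ++ ys.map (· ^ p ^ e')) :=
      (h.perm List.perm_append_comm).forall₂_pow (List.rel_append
        (forall₂_map_pow ts (pow_pos (Fact.out : p.Prime).pos _))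
        (forall₂_map_pow ys (pow_pos (Fact.out : p.Prime).pos _)))
    have h6 := hR.mem_of_mul_prod_pow_mem one_pos n h5 h4
    rw [← hq', List.map_append, map_pow_pow, hperm]
    simpa [Function.comp_def] using h6
  · rw [hperm, ← hq'] at hsc
    have h2 : s * c * ys.prod ^ n ∈
        Ideal.ofList (ts.map (· ^ p ^ e) ++ ys.map (· ^ (1 + n))) :=
      mul_prod_pow_mem_ofList (by simpa using hsc)
    have : s * z ^ p ^ e = s * (z ^ p ^ e - c * ys.prod ^ n) + s * c * ys.prod ^ n := by ring
    rw [List.map_append, hperm, this]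
    have h3 := Ideal.add_mem _ (Ideal.mul_mem_left _ s hc) h2
    rwa [← hq] at h3

variable [IsNoetherianRing R]

omit [CharP R p] [Fact p.Prime] in
/-- Compatible elements modulo the ideals `(ys, ts ^ n)` glue in a complete local ring. -/
theorem exists_sub_mem_of_compatible [IsAdicComplete (maximalIdeal R) R] {ys ts : List R}
    (h : IsSystemOfParameters (ys ++ ts)) (w : ℕ → R)
    (hw : ∀ n, w (n + 1) - w n ∈ Ideal.ofList (ys ++ ts.map (· ^ (n + 1)))) :
    ∃ W, ∀ n, W - w n ∈ Ideal.ofList (ys ++ ts.map (· ^ (n + 1))) := by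
  have htm : ∀ t ∈ ts, t ∈ maximalIdeal R := fun t h' => h.mem (List.mem_append_right _ h')
  have hmono : ∀ n m, n ≤ m → Ideal.ofList (ys ++ ts.map (· ^ (m + 1))) ≤
      Ideal.ofList (ys ++ ts.map (· ^ (n + 1))) := by
    intro n m hnm
    refine Ideal.span_le.2 fun x hx => ?_
    rcases List.mem_append.1 hx with hx | hx
    · exact mem_ofList (List.mem_append_left _ hx)
    · obtain ⟨t, ht, rfl⟩ := List.mem_map.1 hx
      exact Ideal.pow_mem_of_pow_mem _ (mem_ofList (List.mem_append_right _
        (List.mem_map.2 ⟨t, ht, rfl⟩))) (by omega)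
  have h1 : ∀ n, ∃ u ∈ Ideal.ofList ys, w (n + 1) - w n - u ∈ maximalIdeal R ^ n := by
    intro n
    obtain ⟨u, hu, v, hv, huv⟩ := Submodule.mem_sup.1 (ofList_append_map_pow_le htm _ (hw n))
    refine ⟨u, hu, Ideal.pow_le_pow_right n.le_succ ?_⟩
    rwa [← huv, add_sub_cancel_left]
  choose u hu hu' using h1
  let v : ℕ → R := fun n => w n - ∑ i ∈ Finset.range n, u i
  have hv : ∀ n, v (n + 1) - v n ∈ maximalIdeal R ^ n := by
    intro n
    have : v (n + 1) - v n = w (n + 1) - w n - u n := by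
      simp only [v, Finset.sum_range_succ]; ring
    rw [this]
    exact hu' n
  have hv' : ∀ n k, v (n + k) - v n ∈ maximalIdeal R ^ n := by
    intro n k
    induction k with
    | zero => simp
    | succ k ih =>
      rw [← add_assoc, ← sub_add_sub_cancel _ (v (n + k))]
      exact Ideal.add_mem _ (Ideal.pow_le_pow_right (Nat.le_add_right n k) (hv _)) ih
  obtain ⟨W, hW⟩ := IsPrecomplete.prec' (I := maximalIdeal R) v fun {m n} hmn => by
    obtain ⟨k, rfl⟩ := Nat.exists_eq_add_of_le hmn
    rw [SModEq.sub_mem, smul_eq_mul, Ideal.mul_top, ← neg_sub]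
    exact neg_mem (hv' m k)
  have hwk : ∀ n k, w (n + k) - w n ∈ Ideal.ofList (ys ++ ts.map (· ^ (n + 1))) := by
    intro n k
    induction k with
    | zero => simp
    | succ k ih =>
      rw [← add_assoc, ← sub_add_sub_cancel _ (w (n + k))]
      exact Ideal.add_mem _ (hmono n _ (Nat.le_add_right n k) (hw _)) ih
  refine ⟨W, fun n => ?_⟩
  have hsop : IsSystemOfParameters (ys ++ ts.map (· ^ (n + 1))) :=
    h.forall₂_pow (List.rel_append (forall₂_pow_refl ys) (forall₂_map_pow ts n.succ_pos))
  obtain ⟨c, hc⟩ := Ideal.exists_radical_pow_le_of_fg (Ideal.ofList (ys ++ ts.map (· ^ (n + 1))))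
    (IsNoetherian.noetherian _)
  rw [hsop.2] at hc
  have h2 : W - v (n + c) ∈ maximalIdeal R ^ (n + c) := by
    have := hW (n + c)
    rw [SModEq.sub_mem, smul_eq_mul, Ideal.mul_top, ← neg_sub] at this
    exact neg_mem_iff.1 this
  have h3 : ∑ i ∈ Finset.range (n + c), u i ∈ Ideal.ofList (ys ++ ts.map (· ^ (n + 1))) :=
    Ideal.sum_mem _ fun i _ => by
      rw [Ideal.ofList_append]
      exact Ideal.mem_sup_left (hu i)
  have : W - w n = (W - v (n + c)) - ∑ i ∈ Finset.range (n + c), u i + (w (n + c) - w n) := by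
    simp only [v]; ring
  rw [this]
  exact Ideal.add_mem _ (Ideal.sub_mem _ (hc (Ideal.pow_le_pow_right (Nat.le_add_left c n) h2))
    h3) (hwk n c)

theorem mem_aSet_of_frobeniusColon (hR : HasRegularSystemsOfParameters R) (P : Ideal R)
    [hPp : P.IsPrime] {ys : List R} (hyP : ∀ y ∈ ys, y ∈ P)
    (hy : ys.length ≤ (Ideal.ofList ys).height) (hP : P.height = ys.length) {W : R}
    (hW : W ∈ frobeniusColon p P ys) (hW' : W ∉ Ideal.ofList ys) : P ∈ aSet p R := by
  have := charP_localization_atPrime p P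
  refine ⟨hPp, Ideal.ofList (ys.map (algebraMap R (Localization.AtPrime P))),
    algebraMap R _ W, isParameterIdeal_iff.2 ⟨_, isSystemOfParameters_map_atPrime P hyP hy hP,
      rfl⟩, le_antisymm (le_maximalIdeal fun h => ?_) ?_⟩
  · have h1 := mem_ITilde_ofList.1 ((Ideal.eq_top_iff_one _).1 h) 0
    simp only [pow_zero, pow_one, one_mul, List.map_id'] at h1
    rw [← Ideal.map_ofList] at h1
    obtain ⟨m, hm, hmW⟩ := (IsLocalization.algebraMap_mem_map_algebraMap_iff P.primeCompl
      _ _ _).1 h1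
    obtain ⟨Q, v, hQ, hQv, hQw⟩ := exists_isPrime_colon_of_notMem hW'
    have hPQ : P ≤ Q := fun a ha => hQw a (by
      have := mem_frobeniusColon p |>.1 hW a ha 0
      simpa only [pow_zero, pow_one, List.map_id'] using this)
    have := Ideal.eq_of_le_of_height_le P hPQ ((height_le_of_colon hR hy hQv).trans hP.ge)
    exact hm (this ▸ hQw m hmW)
  · rw [← Localization.AtPrime.map_eq_maximalIdeal, Ideal.map_le_iff_le_comap]
    intro a ha
    refine mem_ITilde_ofList.2 fun e => ?_
    have h1 := Ideal.mem_map_of_mem (algebraMap R (Localization.AtPrime P))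
      (mem_frobeniusColon p |>.1 hW a ha e)
    rw [Ideal.map_ofList] at h1
    simpa [Function.comp_def] using h1

theorem mem_aSet_of_ITilde [IsAdicComplete (maximalIdeal R) R]
    (hR : HasRegularSystemsOfParameters R) (P : Ideal R) [P.IsPrime] {ys ts : List R}
    (hyP : ∀ y ∈ ys, y ∈ P) (hy : ys.length ≤ (Ideal.ofList ys).height)
    (hP : P.height = ys.length) (h : IsSystemOfParameters (ys ++ ts)) {z : R}
    (hPz : P = ITilde p (Ideal.ofList (ys ++ ts)) z) : P ∈ aSet p R := by
  obtain ⟨g, hg⟩ := exists_residueField_section (R := R) p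
  let _ : Algebra (ResidueField R) R := g.toAlgebra
  have htm : ∀ t ∈ ts, t ∈ maximalIdeal R := fun t h' => h.mem (List.mem_append_right _ h')
  have hsop : ∀ n, IsSystemOfParameters (ys ++ ts.map (· ^ (n + 1))) := fun n =>
    h.forall₂_pow (List.rel_append (forall₂_pow_refl ys) (forall₂_map_pow ts n.succ_pos))
  obtain ⟨w₀, hw₀⟩ := exists_colon_eq_of_mem_minimalPrimes
    (mem_minimalPrimes_ofList P hyP hy hP)
  have hinter : ∀ (L : List R) (x : R) (k : ℕ), 0 < k →
      (∀ n : ℕ, x ∈ Ideal.ofList (L ++ (ts.map (· ^ k)).map (· ^ (n + 1)))) →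
        x ∈ Ideal.ofList L := by
    intro L x k hk hx
    refine mem_of_forall_mem_sup_pow fun n => ?_
    have hle : Ideal.ofList L ⊔ maximalIdeal R ^ (n + 1) ≤
        Ideal.ofList L ⊔ maximalIdeal R ^ n :=
      sup_le_sup_left (Ideal.pow_le_pow_right n.le_succ) _
    refine hle (ofList_append_map_pow_le (fun t ht => ?_) _ (hx n))
    obtain ⟨t, ht', rfl⟩ := List.mem_map.1 ht
    exact Ideal.pow_mem_of_mem _ (htm t ht') _ hk
  have hsub : ∀ n : ℕ, Ideal.ofList ys ≤ Ideal.ofList (ys ++ ts.map (· ^ (n + 1))) := fun n => by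
    rw [Ideal.ofList_append]
    exact le_sup_left
  obtain ⟨w, hwN, hwI, n₀, hn₀⟩ := exists_compatible_sequence (k := ResidueField R)
    (fun r => ⟨residue R r, by
      rw [← residue_eq_zero_iff, map_sub]
      exact sub_eq_zero.2 (hg _).symm⟩) P ts.prod w₀
    (fun n => Ideal.ofList (ys ++ ts.map (· ^ (n + 1))))
    (fun n => frobeniusColon p P (ys ++ ts.map (· ^ (n + 1))))
    (fun n r => hR.mul_prod_mem_iff h n r)
    (fun n m hnm r hr => by
      obtain ⟨k, rfl⟩ := Nat.exists_eq_add_of_le hnm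
      obtain ⟨c, hc⟩ := hR.mem_span_prod_sup (n := n + 1) (k := k) (r := r) n.succ_pos h
        fun t ht => by
          have := hr (t ^ (n + 1)) (mem_ofList (List.mem_append_right _
            (List.mem_map.2 ⟨t, ht, rfl⟩)))
          rwa [add_right_comm] at this
      refine ⟨c, ?_⟩
      rwa [Nat.add_sub_cancel_left, add_right_comm])
    (fun n => (hsop n).le)
    (fun n => by
      have := Ideal.exists_radical_pow_le_of_fg (Ideal.ofList (ys ++ ts.map (· ^ (n + 1))))
        (IsNoetherian.noetherian _)
      rwa [(hsop n).2] at this)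
    (fun n => ofList_le_frobeniusColon p P _)
    (fun n r => mul_prod_mem_frobeniusColon_iff p hR h P n r)
    (fun a ha n r hr => by
      simpa only [pow_zero, pow_one, List.map_id'] using mem_frobeniusColon p |>.1 hr a ha 0)
    (fun s hs => by
      by_contra hsP
      obtain ⟨n, r, hr, hsr⟩ := exists_mem_frobeniusColon_mul_notMem p hR h hyP hPz hsP
      exact hsr (hs n r hr))
    (fun a ha n => hsub n ((hw₀ a).1 ha))
    (fun s hs => (hw₀ s).2 (hinter ys _ 1 one_pos (by simpa using hs)))
  obtain ⟨W, hW⟩ := exists_sub_mem_of_compatible h w hwI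
  refine mem_aSet_of_frobeniusColon p hR P hyP hy hP (W := W) (fun a ha e => ?_) fun hWy => ?_
  · refine hinter _ _ (p ^ e) (pow_pos (Fact.out : p.Prime).pos e) fun n => ?_
    have h1 : W ∈ frobeniusColon p P (ys ++ ts.map (· ^ (n + 1))) := by
      rw [← sub_add_cancel W (w n)]
      exact Ideal.add_mem _ (ofList_le_frobeniusColon p P _ (hW n)) (hwN n)
    have h2 := mem_frobeniusColon p |>.1 h1 a ha e
    have h3 : (ys ++ ts.map (· ^ (n + 1))).map (· ^ p ^ e) =
        ys.map (· ^ p ^ e) ++ (ts.map (· ^ p ^ e)).map (· ^ (n + 1)) := by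
      simp [pow_right_comm]
    rwa [h3] at h2
  · refine hn₀ ?_
    rw [← sub_sub_cancel W (w n₀)]
    exact Ideal.sub_mem _ (hsub n₀ hWy) (hW n₀)

theorem bSet_subset_aSet [IsAdicComplete (maximalIdeal R) R]
    (hR : HasRegularSystemsOfParameters R) : bSet p R ⊆ aSet p R := by
  rintro P ⟨hPp, I, x, hI, hPI⟩
  obtain ⟨xs, hxs, rfl⟩ := isParameterIdeal_iff.1 hI
  obtain ⟨ys, hyP, hy, hP⟩ := exists_parameters_of_prime P
  obtain ⟨ts, hts⟩ := exists_append_isSystemOfParameters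
    (fun y h => le_maximalIdeal hPp.ne_top (hyP y h)) hy
  obtain ⟨vs, z, hvs, hz⟩ := exists_ITilde_eq_of_isSystemOfParameters p hR hxs hts x
  have hvs' := hts.forall₂_pow hvs
  obtain ⟨us, ws, rfl, h1, -⟩ := exists_append_of_forall₂_append hvs
  exact mem_aSet_of_ITilde p hR P (mem_of_forall₂_pow h1 hyP) (le_height_of_forall₂_pow hy h1)
    (by rw [hP, h1.length_eq]) hvs' (hPI.trans hz)

end GlobalToLocal

/-- **(Enescu.)** Let `(R, 𝔪)` be a complete Cohen–Macaulay Noetherian local ring of prime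
characteristic `p` in which every parameter ideal is Frobenius closed.  Then `B(R) ⊆ A(R)`,
and the maximal elements of `A(R)` coincide with the maximal elements of `B(R)`. -/
theorem bSet_subset_aSet_and_max_eq
    {R : Type*} [CommRing R] [IsLocalRing R] [IsNoetherianRing R]
    (p : ℕ) [Fact p.Prime] [CharP R p]
    [IsAdicComplete (IsLocalRing.maximalIdeal R) R]
    (hCM : IsCohenMacaulayLocal R)
    (hfrob : ∀ J : Ideal R, IsParameterIdeal J → FrobeniusClosed p J) :
    bSet p R ⊆ aSet p R ∧
    {P ∈ aSet p R | ∀ Q ∈ aSet p R, P ≤ Q → Q = P} =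
      {P ∈ bSet p R | ∀ Q ∈ bSet p R, P ≤ Q → Q = P} := by
  have hR : HasRegularSystemsOfParameters R := by
    obtain ⟨n, x, hd, hx, hreg⟩ := hCM
    have : Ideal.ofList (List.ofFn x) = Ideal.span (Set.range x) := by
      simp only [Ideal.ofList, List.mem_ofFn]
      rfl
    exact .of_isWeaklyRegular ⟨by simpa using hd, this ▸ hx⟩ hreg.toIsWeaklyRegular
  have hBA := bSet_subset_aSet p hR
  refine ⟨hBA, Set.ext fun P => ⟨fun ⟨hP, hmax⟩ => ?_, fun ⟨hP, hmax⟩ => ?_⟩⟩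
  · obtain ⟨Q, hQ, hPQ⟩ := exists_le_mem_bSet_of_mem_aSet p hR hP
    obtain rfl := hmax Q (hBA hQ) hPQ
    exact ⟨hQ, fun Q' hQ' => hmax Q' (hBA hQ')⟩
  · refine ⟨hBA hP, fun Q hQ hPQ => ?_⟩
    obtain ⟨Q', hQ', hQQ'⟩ := exists_le_mem_bSet_of_mem_aSet p hR hQ
    have := hmax Q' hQ' (hPQ.trans hQQ')
    exact le_antisymm (this ▸ hQQ') hPQ
end

section
/- Let (R, 𝔪) be a Cohen–Macaulay Noetherian local ring of prime characteristic p in which every parameter ideal is Frobenius closed, let I be a parameter ideal of R, and let u ∈ R with u ∉ I and 𝔪 ⊆ I(u). Then for every q = p^e, the colon ideal (I^{[q]} :_R u^q) = {c ∈ R : c·u^q ∈ I^{[q]}} equals 𝔪. -/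
/-- Let `(R, 𝔪)` be a Cohen–Macaulay Noetherian local ring of prime characteristic `p` in
which every parameter ideal is Frobenius closed, let `I` be a parameter ideal and `u ∈ R` with
`u ∉ I` and `𝔪 ⊆ I(u)`.  Then for every `q = p^e` the colon ideal `(I^{[q]} :_R u^q)` equals
`𝔪`. -/
theorem colon_bracketPow_eq_maximalIdeal
    {R : Type*} [CommRing R] [IsLocalRing R] [IsNoetherianRing R]
    (p : ℕ) [Fact p.Prime] [CharP R p]
    (hCM : IsCohenMacaulayLocal R)
    (hfrob : ∀ J : Ideal R, IsParameterIdeal J → FrobeniusClosed p J)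
    (I : Ideal R) (hI : IsParameterIdeal I) (u : R) (hu : u ∉ I)
    (hm : IsLocalRing.maximalIdeal R ≤ ITilde p I u) :
    ∀ e : ℕ, Submodule.colon (bracketPow I (p ^ e)) (Ideal.span {u ^ p ^ e}) =
      IsLocalRing.maximalIdeal R := by
  intro e
  refine ((IsLocalRing.maximalIdeal.isMaximal R).eq_of_le ?_
    (hm.trans (iInf_le (fun e : ℕ => Submodule.colon (bracketPow I (p ^ e))
      (Ideal.span {u ^ p ^ e})) e))).symm
  intro htop
  have hone := (Ideal.eq_top_iff_one _).1 htop
  have hpow := Submodule.mem_colon.1 hone (u ^ p ^ e) (Ideal.mem_span_singleton_self _)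
  exact hu (hfrob I hI u ⟨e, by simpa using hpow⟩)
end

section
/- Let (R, 𝔪, k) be a complete Noetherian local domain of Krull dimension 1 and prime characteristic p whose residue field k is algebraically closed. If every parameter ideal of R is Frobenius closed (i.e., R is F-injective), then R is a regular local ring. -/
/-- A regular local ring: a Noetherian local ring whose maximal ideal can be generated by
`d = dim` elements. -/
def IsRegularLocal (A : Type*) [CommRing A] [IsLocalRing A] : Prop :=
  IsNoetherianRing A ∧ ∃ (n : ℕ) (x : Fin n → A),
    ringKrullDim A = n ∧ IsLocalRing.maximalIdeal A = Ideal.span (Set.range x)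

open Polynomial IsLocalRing

/-- A local domain all of whose parameter ideals are Frobenius closed is closed under
`p ^ e`-th roots in its fraction field. -/
theorem mem_range_of_pow_mem_range {p : ℕ} {R K : Type*} [CommRing R] [IsDomain R]
    [IsLocalRing R] [Field K] [Algebra R K] [IsFractionRing R K]
    (hfrob : ∀ x : R, x ∈ maximalIdeal R → x ≠ 0 → FrobeniusClosed p (Ideal.span {x}))
    {t : K} {e : ℕ} (ht : t ^ p ^ e ∈ (algebraMap R K).range) :
    t ∈ (algebraMap R K).range := by
  obtain ⟨a, b, hb, rfl⟩ := IsFractionRing.div_surjective (A := R) t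
  have hb0 : b ≠ 0 := nonZeroDivisors.ne_zero hb
  have hbK : algebraMap R K b ≠ 0 := by simpa using hb0
  obtain ⟨r, hr⟩ := ht
  have hpow : a ^ p ^ e = r * b ^ p ^ e := by
    apply IsFractionRing.injective R K
    rw [div_pow, eq_div_iff (pow_ne_zero _ hbK)] at hr
    simp [hr]
  have hmem : a ∈ Ideal.span {b} := by
    by_cases hbm : b ∈ maximalIdeal R
    · refine hfrob b hbm hb0 a ⟨e, ?_⟩
      rw [hpow]
      exact Ideal.mul_mem_left _ _
        (Ideal.subset_span ⟨b, Ideal.mem_span_singleton_self b, rfl⟩)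
    · simp [Ideal.span_singleton_eq_top.2 (not_not.1 hbm)]
  obtain ⟨d, rfl⟩ := Ideal.mem_span_singleton'.1 hmem
  exact ⟨d, by simp [hbK]⟩

/-- If `c` is a common denominator of the powers of `s`, then it clears the denominator of `P(s)`
for every polynomial `P`, with a numerator in any ideal containing the coefficients of `P`. -/
theorem exists_mem_smul_aeval_eq_algebraMap {R S : Type*} [CommRing R] [CommRing S] [Algebra R S]
    {s : S} {c : R} (hc : ∀ n, c • s ^ n ∈ (algebraMap R S).range) {I : Ideal R} {P : R[X]}
    (hP : P ∈ I.map C) : ∃ r ∈ I, c • aeval s P = algebraMap R S r := by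
  choose d hd using hc
  refine ⟨∑ i ∈ Finset.range (P.natDegree + 1), P.coeff i * d i,
    sum_mem fun i _ => I.mul_mem_right _ (Ideal.mem_map_C_iff.1 hP i), ?_⟩
  rw [aeval_eq_sum_range, Finset.smul_sum, map_sum]
  refine Finset.sum_congr rfl fun i _ => ?_
  rw [map_mul, hd, smul_comm, Algebra.smul_def]

theorem Polynomial.Splits.dvd_prod_roots_pow {k : Type*} [Field k] [DecidableEq k] {f : k[X]}
    (hf : f.Splits) (hm : f.Monic) :
    f ∣ (∏ a ∈ f.roots.toFinset, (X - C a)) ^ f.roots.card := by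
  conv_lhs => rw [hf.eq_prod_roots_of_monic hm]
  rw [Finset.prod_multiset_map_count, ← Finset.prod_pow]
  exact Finset.prod_dvd_prod_of_dvd _ _ fun a _ => pow_dvd_pow _ (Multiset.count_le_card _ _)

/-- Over a Henselian local ring, a monic polynomial whose reduction is a product of distinct
linear factors has all its roots (in any domain containing the ring) in the ring. -/
theorem mem_range_of_aeval_eq_zero_of_map_residue_eq_prod {R K : Type*} [CommRing R]
    [IsLocalRing R] [HenselianRing R (maximalIdeal R)] [CommRing K] [IsDomain K]
    [Algebra R K] [FaithfulSMul R K] {G : R[X]} (hG : G.Monic) {A : Finset (ResidueField R)}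
    (hA : G.map (residue R) = ∏ a ∈ A, (X - C a)) {s : K} (hs : aeval s G = 0) :
    s ∈ (algebraMap R K).range := by
  classical
  have hsep : (G.map (residue R)).Separable := by
    rw [hA]
    exact separable_prod_X_sub_C_iff'.2 fun _ _ _ _ h => h
  have hroot : ∀ a ∈ A, ∃ r : R, G.IsRoot r ∧ residue R r = a := by
    intro a ha
    obtain ⟨b, rfl⟩ := residue_surjective a
    have hev : (G.map (residue R)).eval (residue R b) = 0 := by
      rw [hA, eval_prod]
      exact Finset.prod_eq_zero ha (by simp)
    have hder : (G.map (residue R)).derivative.eval (residue R b) ≠ 0 :=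
      hsep.eval₂_derivative_ne_zero (RingHom.id _) hev
    obtain ⟨r, hr, hrb⟩ := HenselianRing.is_henselian (I := maximalIdeal R) G hG b
      (by rwa [← residue_eq_zero_iff, ← eval₂_at_apply, ← eval_map])
      (by
        refine IsUnit.map _ ?_
        rw [← residue_ne_zero_iff_isUnit, ← eval₂_at_apply, ← eval_map, ← derivative_map]
        exact hder)
    exact ⟨r, hr, by rwa [← sub_eq_zero, ← map_sub, residue_eq_zero_iff]⟩
  choose! r hr hra using hroot
  by_contra hsR
  have hinj : Function.Injective (algebraMap R K) := FaithfulSMul.algebraMap_injective R K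
  have hGK : (G.map (algebraMap R K)) ≠ 0 := (hG.map _).ne_zero
  have hsub : insert s (A.image fun a => algebraMap R K (r a)) ⊆
      (G.map (algebraMap R K)).roots.toFinset := by
    intro x hx
    rw [Multiset.mem_toFinset, mem_roots hGK, IsRoot, eval_map_algebraMap]
    rcases Finset.mem_insert.1 hx with rfl | hx
    · exact hs
    · obtain ⟨a, ha, rfl⟩ := Finset.mem_image.1 hx
      rw [aeval_algebraMap_apply, coe_aeval_eq_eval, hr a ha, map_zero]
  have hle := (Finset.card_le_card hsub).trans
    ((Multiset.toFinset_card_le _).trans (card_roots' _))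
  rw [Finset.card_insert_of_notMem, Finset.card_image_of_injOn, hG.natDegree_map,
    ← hG.natDegree_map (residue R), hA, natDegree_finsetProd_X_sub_C_eq_card] at hle
  · omega
  · intro a ha b hb hab
    rw [← hra a ha, ← hra b hb, hinj hab]
  · intro h
    obtain ⟨a, -, rfl⟩ := Finset.mem_image.1 h
    exact hsR ⟨_, rfl⟩

/-- A Henselian Noetherian local domain of dimension at most one with algebraically closed residue
field is integrally closed if its parameter ideals are Frobenius closed. -/
theorem isIntegrallyClosed_of_fInjective {p : ℕ} (hp : 1 < p) {R : Type*} [CommRing R] [IsDomain R]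
    [IsLocalRing R] [IsNoetherianRing R] [HenselianRing R (maximalIdeal R)]
    [IsAlgClosed (ResidueField R)]
    (hdim : ∀ x : R, x ≠ 0 → maximalIdeal R ≤ (Ideal.span {x}).radical)
    (hfrob : ∀ x : R, x ∈ maximalIdeal R → x ≠ 0 → FrobeniusClosed p (Ideal.span {x})) :
    IsIntegrallyClosed R := by
  classical
  rw [isIntegrallyClosed_iff (FractionRing R)]
  intro s hs
  obtain ⟨c, hc0, hc⟩ := hs.isAlmostIntegral
  have hc0 : c ≠ 0 := nonZeroDivisors.ne_zero hc0
  obtain ⟨f, hf, hfs⟩ := hs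
  obtain ⟨N, hN⟩ := Ideal.exists_pow_le_of_le_radical_of_fg (hdim c hc0)
    (IsNoetherian.noetherian _)
  set fbar := f.map (residue R)
  set n := fbar.roots.card
  set A := fbar.roots.toFinset
  obtain ⟨l, hl⟩ := (residue_surjective (R := R)).hasRightInverse
  set g : R[X] := ∏ a ∈ A, (X - C (l a)) with hg
  have hgm : g.Monic := monic_prod_of_monic _ _ fun a _ => monic_X_sub_C _
  have hgbar : g.map (residue R) = ∏ a ∈ A, (X - C a) := by
    simp [hg, Polynomial.map_prod, hl _]
  set h := g ^ n %ₘ f with hh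
  have hhm : h ∈ (maximalIdeal R).map C := by
    rw [Ideal.mem_map_C_iff]
    intro i
    rw [← residue_eq_zero_iff, ← coeff_map, hh, map_modByMonic _ hf, Polynomial.map_pow, hgbar,
      (modByMonic_eq_zero_iff_dvd (hf.map _)).2
        ((IsAlgClosed.splits _).dvd_prod_roots_pow (hf.map _)), coeff_zero]
  have hgs : aeval s g ^ n = aeval s h := by
    rw [← map_pow, hh]
    conv_lhs => rw [← modByMonic_add_div (g ^ n) f]
    simp [aeval_def, hfs]
  have hhpow (M : ℕ) : h ^ M ∈ (maximalIdeal R ^ M).map C := by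
    rw [Ideal.map_pow]
    exact Ideal.pow_mem_pow hhm M
  obtain ⟨u, hu⟩ : aeval s g ∈ (algebraMap R (FractionRing R)).range := by
    refine mem_range_of_pow_mem_range hfrob (e := n * N) ?_
    obtain ⟨j, hj⟩ := Nat.exists_eq_add_of_le (Nat.lt_pow_self hp (n := n * N)).le
    obtain ⟨r, hr, hrs⟩ := exists_mem_smul_aeval_eq_algebraMap hc
      (Ideal.mul_mem_right (g ^ j) _ (hhpow N))
    obtain ⟨d, rfl⟩ := Ideal.mem_span_singleton'.1 (hN hr)
    refine ⟨d, ?_⟩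
    rw [hj, pow_add, pow_mul, hgs, ← map_pow, ← map_pow, ← map_mul]
    refine mul_left_cancel₀ (a := algebraMap R (FractionRing R) c) (by simpa using hc0) ?_
    rw [← Algebra.smul_def _ (aeval s _), hrs, map_mul, mul_comm]
  have hum : u ∈ maximalIdeal R := by
    by_contra hun
    have hun : IsUnit u := by simpa using hun
    refine hc0 ?_
    rw [← Ideal.mem_bot, ← Ideal.iInf_pow_eq_bot_of_isLocalRing (maximalIdeal R)
      (Ideal.IsPrime.ne_top inferInstance), Ideal.mem_iInf]
    intro M
    obtain ⟨r, hr, hrs⟩ := exists_mem_smul_aeval_eq_algebraMap hc (hhpow M)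
    rw [map_pow, ← hgs, ← hu, Algebra.smul_def, ← map_pow, ← map_pow, ← map_mul] at hrs
    rw [← IsFractionRing.injective R _ hrs] at hr
    exact (Ideal.mul_unit_mem_iff_mem _ ((hun.pow n).pow M)).1 hr
  have hdeg : 0 < g.degree := by
    rw [← natDegree_pos_iff_degree_pos]
    by_contra! h0
    have hg1 : g = 1 := hgm.natDegree_eq_zero.1 (by omega)
    rw [hg1, map_one, ← map_one (algebraMap R (FractionRing R))] at hu
    rw [IsFractionRing.injective R _ hu] at hum
    exact Ideal.IsPrime.one_notMem inferInstance hum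
  refine mem_range_of_aeval_eq_zero_of_map_residue_eq_prod (G := g - C u) (A := A)
    (hgm.sub_of_left (degree_C_le.trans_lt hdeg)) ?_ (by simp [hu])
  rw [Polynomial.map_sub, hgbar, map_C, (residue_eq_zero_iff u).2 hum, C_0, sub_zero]

/-- Let `(R, 𝔪, k)` be a complete Noetherian local domain of Krull dimension `1` and prime
characteristic `p` whose residue field is algebraically closed.  If every parameter ideal of
`R` (i.e. every ideal generated by a single nonzero element of `𝔪`) is Frobenius closed, then
`R` is a regular local ring. -/
theorem regular_of_one_dimensional_fInjective
    (p : ℕ) [Fact p.Prime]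
    (R : Type*) [CommRing R] [IsDomain R] [IsLocalRing R] [IsNoetherianRing R] [CharP R p]
    [IsAdicComplete (IsLocalRing.maximalIdeal R) R]
    [IsAlgClosed (IsLocalRing.ResidueField R)]
    (hdim : ringKrullDim R = 1)
    (hfrob : ∀ x : R, x ∈ IsLocalRing.maximalIdeal R → x ≠ 0 →
      FrobeniusClosed p (Ideal.span {x})) :
    IsRegularLocal R := by
  obtain ⟨-, hrad⟩ := ringKrullDim_eq_one_iff_of_isLocalRing_isDomain.1 hdim
  have hic := isIntegrallyClosed_of_fInjective (Fact.out : p.Prime).one_lt hrad hfrob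
  have hprime (P : Ideal R) (hP0 : P ≠ ⊥) (hP : P.IsPrime) : P = maximalIdeal R := by
    obtain ⟨x, hxP, hx0⟩ := Submodule.exists_mem_ne_zero_of_ne_bot hP0
    exact (le_maximalIdeal hP.ne_top).antisymm
      ((hrad x hx0).trans (hP.radical_le_iff.2 ((Ideal.span_singleton_le_iff_mem P).2 hxP)))
  have hprinc : (maximalIdeal R).IsPrincipal :=
    ((tfae_of_isNoetherianRing_of_isLocalRing_of_isDomain R).out 3 4).1
      (And.intro hic hprime)
  obtain ⟨x, hx⟩ := hprinc
  exact ⟨inferInstance, 1, fun _ => x, by simpa using hdim, by simpa using hx⟩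
end
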